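/- arXiv:math/0510570 — 2 statements merged into one kernel-verified Lean document; each statement's English description precedes it below -/
import Mathlib

section
/- Let q ≥ 3 be an integer and let ℒ_q(s) = ∏_χ L(s,χ) be the product of the Dirichlet L-functions over all Dirichlet characters χ modulo q. Then there is at most one real number β with 1 − 1/(4.0904 · log q) ≤ β < 1 and ℒ_q(β) = 0. -/
set_option autoImplicit false

open scoped Real

open Complex

open Filter Topology in
/-- Dividing an entire function by a power of `z - a` so as to remove its zero at `a`. -/
lemma exists_entire_div_pow {f : ℂ → ℂ} (hf : Differentiable ℂ f) (hne : ∃ p, f p ≠ 0) (a : ℂ) :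
    ∃ (n : ℕ) (g : ℂ → ℂ), Differentiable ℂ g ∧ g a ≠ 0 ∧ ∀ z, f z = (z - a) ^ n * g z := by
  have hfa : AnalyticAt ℂ f a := hf.analyticAt a
  have htop : analyticOrderAt f a ≠ ⊤ := by
    intro h
    rw [analyticOrderAt_eq_top] at h
    obtain ⟨p, hp⟩ := hne
    apply hp
    have := (AnalyticOnNhd.eqOn_zero_of_preconnected_of_eventuallyEq_zero
      (f := f) (U := Set.univ) (fun z _ => hf.analyticAt z) isPreconnected_univ
      (Set.mem_univ a) h) (Set.mem_univ p)
    simpa using this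
  obtain ⟨g, hg, hga, hfg⟩ := (hfa.analyticOrderAt_ne_top).1 htop
  set n := analyticOrderNatAt f a
  let G : ℂ → ℂ := fun z => if z = a then g a else f z / (z - a) ^ n
  have hGa : G =ᶠ[𝓝 a] g := by
    filter_upwards [hfg] with z hz
    by_cases h : z = a
    · simp [G, h]
    · have : (z - a) ^ n ≠ 0 := pow_ne_zero _ (sub_ne_zero.2 h)
      simp only [G, h, if_false, hz, smul_eq_mul]
      field_simp
  refine ⟨n, G, fun z => ?_, by simpa [G] using hga, fun z => ?_⟩
  · by_cases h : z = a
    · subst h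
      exact hGa.differentiableAt_iff.2 hg.differentiableAt
    · have h1 : G =ᶠ[𝓝 z] fun z => f z / (z - a) ^ n := by
        filter_upwards [isOpen_ne.mem_nhds h] with w hw
        have hw' : w ≠ a := hw
        simp [G, hw']
      refine h1.differentiableAt_iff.2 ?_
      exact (hf z).div (by fun_prop) (pow_ne_zero _ (sub_ne_zero.2 h))
  · by_cases h : z = a
    · subst h
      have := hfg.self_of_nhds
      simpa [G] using this
    · have : (z - a) ^ n ≠ 0 := pow_ne_zero _ (sub_ne_zero.2 h)
      simp only [G, h, if_false]
      field_simp

lemma finite_zeros_of_isCompact {f : ℂ → ℂ} (hf : Differentiable ℂ f) (hne : ∃ p, f p ≠ 0)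
    {K : Set ℂ} (hK : IsCompact K) : {z ∈ K | f z = 0}.Finite := by
  by_contra h
  obtain ⟨x, hxK, hx⟩ := Set.Infinite.exists_accPt_of_subset_isCompact h hK (fun z hz => hz.1)
  obtain ⟨p, hp⟩ := hne
  apply hp
  have := AnalyticOnNhd.eqOn_zero_of_preconnected_of_frequently_eq_zero
      (f := f) (U := Set.univ) (fun z _ => hf.analyticAt z) isPreconnected_univ
      (Set.mem_univ x) (by
        rw [accPt_iff_frequently_nhdsNE] at hx
        exact hx.mono fun z hz => hz.2)
  exact this (Set.mem_univ p)

/-- Factoring out of an entire function its zeros in a compact set. -/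
lemma exists_zero_factorization {f : ℂ → ℂ} (hf : Differentiable ℂ f) (hne : ∃ p, f p ≠ 0)
    {K : Set ℂ} (hK : IsCompact K) :
    ∃ (s : Multiset ℂ) (g : ℂ → ℂ), Differentiable ℂ g ∧
      (∀ z, f z = (s.map fun a => z - a).prod * g z) ∧ (∀ a ∈ s, a ∈ K) ∧
      ∀ z ∈ K, g z ≠ 0 := by
  generalize hN : {z ∈ K | f z = 0}.ncard = N
  induction N using Nat.strong_induction_on generalizing f with
  | _ N ih =>
    by_cases h0 : ∀ z ∈ K, f z ≠ 0
    · exact ⟨0, f, hf, by simp, by simp, h0⟩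
    push Not at h0
    obtain ⟨a, haK, ha⟩ := h0
    obtain ⟨n, g, hg, hga, hfg⟩ := exists_entire_div_pow hf hne a
    have hlt : {z ∈ K | g z = 0}.ncard < N := by
      rw [← hN]
      refine Set.ncard_lt_ncard ?_ (finite_zeros_of_isCompact hf hne hK)
      refine ⟨fun z hz => ⟨hz.1, by rw [hfg, hz.2, mul_zero]⟩, fun h => hga ?_⟩
      exact (h ⟨haK, ha⟩).2
    obtain ⟨s, g', hg', hs, hsK, hK'⟩ := ih _ hlt hg ⟨a, hga⟩ rfl
    refine ⟨Multiset.replicate n a + s, g', hg', fun z => ?_, ?_, hK'⟩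
    · rw [hfg, hs]; simp [mul_assoc]
    · intro b hb
      rcases Multiset.mem_add.1 hb with hb | hb
      · rw [Multiset.eq_of_mem_replicate hb]; exact haK
      · exact hsK b hb

open Metric Filter Topology in
lemma norm_logDeriv_sub_logDeriv_le_zero {h : ℂ → ℂ} {R A : ℝ} (hh : Differentiable ℂ h)
    (hR : 0 < R) (hA : 0 < A) (h0 : ∀ z ∈ ball (0 : ℂ) R, h z ≠ 0)
    (hb : ∀ z ∈ ball (0 : ℂ) R, ‖h z‖ ≤ Real.exp A * ‖h 0‖) {x y : ℂ}
    (hx : x ∈ ball (0 : ℂ) (R / 4)) (hy : y ∈ ball (0 : ℂ) (R / 4)) :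
    ‖logDeriv h x - logDeriv h y‖ ≤ 64 * A / R ^ 2 * ‖x - y‖ := by
  have hh' : Differentiable ℂ (deriv h) := fun z =>
    ((hh.analyticAt z).deriv).differentiableAt
  have hld : DifferentiableOn ℂ (logDeriv h) (ball 0 R) := fun z hz =>
    ((hh' z).div (hh z) (h0 z hz)).differentiableWithinAt
  obtain ⟨H, H0, HH⟩ := (hld.isExactOn_ball).with_val_at 0 0
  have hHd : DifferentiableOn ℂ H (ball 0 R) := fun z hz =>
    (HH z hz).differentiableAt.differentiableWithinAt
  have key : ∀ z ∈ ball (0 : ℂ) R, h z = h 0 * cexp (H z) := by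
    intro z hz
    have hc : ∀ w ∈ ball (0 : ℂ) R, HasDerivAt (fun w => h w * cexp (-H w)) 0 w := by
      intro w hw
      have := (hh w).hasDerivAt.mul ((HH w hw).neg.cexp)
      refine HasDerivAt.congr_deriv this ?_
      have := h0 w hw
      rw [logDeriv_apply]
      field_simp
      ring
    have := isOpen_ball.is_const_of_deriv_eq_zero (convex_ball (0 : ℂ) R).isPreconnected
      (fun w hw => (hc w hw).differentiableAt.differentiableWithinAt)
      (fun w hw => (hc w hw).deriv) hz (mem_ball_self hR)
    simp only [H0, neg_zero, Complex.exp_zero, mul_one] at this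
    rw [← this, mul_assoc, ← Complex.exp_add]
    simp
  have hre : Set.MapsTo H (ball 0 R) {z | z.re ≤ A} := by
    intro z hz
    have h1 := hb z hz
    rw [key z hz, norm_mul, mul_comm, Complex.norm_exp] at h1
    have h2 : 0 < ‖h 0‖ := norm_pos_iff.2 (h0 0 (mem_ball_self hR))
    exact Real.exp_le_exp.1 (le_of_mul_le_mul_right h1 h2)
  have hHb : ∀ z ∈ closedBall (0 : ℂ) (R / 2), ‖H z‖ ≤ 2 * A := by
    intro z hz
    have hz' : ‖z‖ ≤ R / 2 := by simpa using hz
    have hzR : z ∈ ball (0 : ℂ) R := by simp; linarith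
    refine (borelCaratheodory_zero hA hHd hre hR hzR H0).trans ?_
    rw [div_le_iff₀ (by linarith)]
    nlinarith
  have hd2 : ∀ c ∈ ball (0 : ℂ) (R / 4), ‖deriv (logDeriv h) c‖ ≤ 64 * A / R ^ 2 := by
    intro c hc
    have hc' : ‖c‖ < R / 4 := by simpa using hc
    have hcR : c ∈ ball (0 : ℂ) R := by simp; linarith
    have e1 : logDeriv h =ᶠ[𝓝 c] deriv H := by
      filter_upwards [isOpen_ball.mem_nhds hcR] with w hw
      exact (HH w hw).deriv.symm
    have hsub : closedBall c (R / 4) ⊆ closedBall (0 : ℂ) (R / 2) := by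
      apply closedBall_subset_closedBall'
      simp; linarith
    have hsub' : closedBall (0 : ℂ) (R / 2) ⊆ ball 0 R := closedBall_subset_ball (by linarith)
    have := norm_iteratedDeriv_le_of_forall_mem_sphere_norm_le (c := c) (f := H) 2
      (show 0 < R / 4 by positivity) (C := 2 * A)
      (DifferentiableOn.diffContOnCl_ball (U := ball 0 R) hHd (hsub.trans hsub'))
      (fun z hz => hHb z (hsub (sphere_subset_closedBall hz)))
    rw [e1.deriv_eq]
    rw [iteratedDeriv_succ, iteratedDeriv_one] at this
    refine this.trans (le_of_eq ?_)
    simp [Nat.factorial]; field_simp; norm_num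
  refine (convex_ball (0 : ℂ) (R / 4)).norm_image_sub_le_of_norm_deriv_le (𝕜 := ℂ)
    (fun w hw => ?_) hd2 hy hx
  have hw' : ‖w‖ < R / 4 := by simpa using hw
  exact hld.differentiableAt (isOpen_ball.mem_nhds (by simp; linarith))

open Metric in
lemma norm_logDeriv_sub_logDeriv_le {g : ℂ → ℂ} {R A : ℝ} {p : ℂ} (hg : Differentiable ℂ g)
    (hR : 0 < R) (hA : 0 < A) (h0 : ∀ z ∈ ball p R, g z ≠ 0)
    (hb : ∀ z ∈ ball p R, ‖g z‖ ≤ Real.exp A * ‖g p‖) {x y : ℂ}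
    (hx : x ∈ ball p (R / 4)) (hy : y ∈ ball p (R / 4)) :
    ‖logDeriv g x - logDeriv g y‖ ≤ 64 * A / R ^ 2 * ‖x - y‖ := by
  have hcomp : ∀ z, logDeriv (fun w => g (p + w)) (z - p) = logDeriv g z := by
    intro z
    rw [logDeriv_apply, logDeriv_apply, deriv_comp_const_add]
    simp
  have hmem : ∀ {r : ℝ} {z : ℂ}, z ∈ ball (0 : ℂ) r → p + z ∈ ball p r := by
    intro r z hz; simpa using hz
  have := norm_logDeriv_sub_logDeriv_le_zero (h := fun w => g (p + w)) (R := R) (A := A)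
    (by fun_prop) hR hA (fun z hz => h0 _ (hmem hz)) (fun z hz => by simpa using hb _ (hmem hz))
    (x := x - p) (y := y - p) (by simpa [dist_eq_norm] using hx) (by simpa [dist_eq_norm] using hy)
  rw [hcomp, hcomp] at this
  simpa using this

open Metric in
lemma norm_le_of_zero_factorization {f g : ℂ → ℂ} {p : ℂ} {R A : ℝ} (s : Multiset ℂ)
    (hR : 0 < R) (hg : Differentiable ℂ g)
    (hfg : ∀ z, f z = (s.map fun a => z - a).prod * g z) (hs : ∀ a ∈ s, a ∈ closedBall p R)
    (hp : f p ≠ 0) (hb : ∀ z ∈ closedBall p (2 * R), ‖f z‖ ≤ Real.exp A * ‖f p‖) {z : ℂ}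
    (hz : z ∈ closedBall p (2 * R)) : ‖g z‖ ≤ Real.exp A * ‖g p‖ := by
  have hnorm : ∀ z, ‖f z‖ = (s.map fun a => ‖z - a‖).prod * ‖g z‖ := by
    intro z
    rw [hfg, norm_mul]
    congr 1
    exact (Multiset.prod_hom' s (normHom : ℂ →*₀ ℝ) fun a => z - a).symm
  have hP : 0 < (s.map fun a => ‖p - a‖).prod := by
    refine lt_of_le_of_ne (Multiset.prod_nonneg ?_) fun h => hp ?_
    · intro b hb
      obtain ⟨a, -, rfl⟩ := Multiset.mem_map.1 hb
      exact norm_nonneg _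
    · rw [← norm_eq_zero, hnorm, ← h, zero_mul]
  refine Complex.norm_le_of_forall_mem_frontier_norm_le (U := ball p (2 * R)) isBounded_ball
    hg.diffContOnCl ?_ (by rwa [closure_ball _ (by positivity)])
  intro z hz
  rw [frontier_ball _ (by positivity)] at hz
  have h1 := hb z (sphere_subset_closedBall hz)
  rw [hnorm, hnorm p] at h1
  have h2 : (s.map fun a => ‖p - a‖).prod ≤ (s.map fun a => ‖z - a‖).prod := by
    refine Multiset.prod_map_le_prod_map₀ _ _ (fun a _ => norm_nonneg _) fun a ha => ?_
    have h3 := hs a ha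
    have h4 : ‖z - p‖ = 2 * R := by simpa [dist_eq_norm] using hz
    have h5 : ‖a - p‖ ≤ R := by simpa [dist_eq_norm] using h3
    have h6 := norm_sub_norm_le (z - p) (a - p)
    rw [norm_sub_rev p a]
    simp only [sub_sub_sub_cancel_right] at h6
    linarith
  have h3 := mul_le_mul_of_nonneg_right h2 (norm_nonneg (g z))
  refine le_of_mul_le_mul_left ?_ hP
  linarith

lemma logDeriv_multiset_prod_sub (s : Multiset ℂ) {x : ℂ} (hx : (s.map fun a => x - a).prod ≠ 0) :
    logDeriv (fun z => (s.map fun a => z - a).prod) x = (s.map fun a => 1 / (x - a)).sum := by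
  induction s using Multiset.induction_on with
  | empty => simp
  | cons a s ih =>
    simp only [Multiset.map_cons, Multiset.prod_cons, ne_eq, mul_eq_zero, not_or] at hx
    simp only [Multiset.map_cons, Multiset.prod_cons, Multiset.sum_cons]
    have hd : Differentiable ℂ fun z : ℂ => (s.map fun a => z - a).prod := by
      clear ih hx
      induction s using Multiset.induction_on with
      | empty => simp
      | cons b s ih => simp only [Multiset.map_cons, Multiset.prod_cons]; fun_prop
    rw [logDeriv_mul x hx.1 hx.2 (by fun_prop) (hd x), ih hx.2]
    congr 1
    simp [logDeriv_apply]

open Metric in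
/-- Local form of the Hadamard factorization: on a disc, the difference of two values of the
logarithmic derivative is that coming from finitely many zeros, up to a controlled error. -/
lemma exists_multiset_logDeriv_sub {f : ℂ → ℂ} {p : ℂ} {R A : ℝ} (hf : Differentiable ℂ f)
    (hR : 0 < R) (hA : 0 < A) (hp : f p ≠ 0)
    (hb : ∀ z ∈ closedBall p (2 * R), ‖f z‖ ≤ Real.exp A * ‖f p‖) :
    ∃ s : Multiset ℂ, (∀ a ∈ s, f a = 0) ∧ (∀ a ∈ closedBall p R, f a = 0 → a ∈ s) ∧
      ∀ x ∈ ball p (R / 4), ∀ y ∈ ball p (R / 4), f x ≠ 0 → f y ≠ 0 →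
        ‖logDeriv f x - logDeriv f y - (s.map fun a => 1 / (x - a) - 1 / (y - a)).sum‖ ≤
          64 * A / R ^ 2 * ‖x - y‖ := by
  obtain ⟨s, g, hg, hfg, hs, hgK⟩ :=
    exists_zero_factorization hf ⟨p, hp⟩ (isCompact_closedBall p R)
  have hd : Differentiable ℂ fun z : ℂ => (s.map fun a => z - a).prod := by
    clear hs hfg
    induction s using Multiset.induction_on with
    | empty => simp
    | cons b s ih => simp only [Multiset.map_cons, Multiset.prod_cons]; fun_prop
  have hld : ∀ x, f x ≠ 0 → logDeriv f x = (s.map fun a => 1 / (x - a)).sum + logDeriv g x := by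
    intro x hx
    rw [hfg] at hx
    have hx1 := left_ne_zero_of_mul hx
    have hx2 := right_ne_zero_of_mul hx
    rw [← logDeriv_multiset_prod_sub s hx1, ← logDeriv_mul x hx1 hx2 (hd x) (hg x)]
    congr 1
    ext z; exact hfg z
  refine ⟨s, fun a ha => ?_, fun a haK ha => ?_, fun x hx y hy hfx hfy => ?_⟩
  · rw [hfg, Multiset.prod_eq_zero, zero_mul]
    exact Multiset.mem_map.2 ⟨a, ha, sub_self a⟩
  · rw [hfg, mul_eq_zero, or_iff_left (hgK a haK), Multiset.prod_eq_zero_iff] at ha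
    obtain ⟨b, hb, hab⟩ := Multiset.mem_map.1 ha
    rwa [sub_eq_zero.1 hab]
  · rw [hld x hfx, hld y hfy, Multiset.sum_map_sub]
    have := norm_logDeriv_sub_logDeriv_le (p := p) hg hR hA
      (fun z hz => hgK z (ball_subset_closedBall hz))
      (fun z hz => norm_le_of_zero_factorization s hR hg hfg hs hp hb
        (closedBall_subset_closedBall (by linarith) (ball_subset_closedBall hz))) hx hy
    convert this using 2
    ring

open Metric Filter Topology in
/-- For an entire function of order less than `2`, a weighted sum of differences of values of the
logarithmic derivative is bounded below by the contribution of finitely many zeros, provided that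
every zero contributes nonnegatively. -/
theorem sum_le_sum_re_logDeriv_sub {ι : Type*} [Fintype ι] {f : ℂ → ℂ} (hf : Differentiable ℂ f)
    {C : ℝ} (hC : ∀ z, ‖f z‖ ≤ Real.exp (C * (1 + ‖z‖) ^ (3 / 2 : ℝ))) (w : ι → ℝ) (x y : ι → ℂ)
    (hx : ∀ j, f (x j) ≠ 0) (hy : ∀ j, f (y j) ≠ 0) {p : ℂ} (hp : f p ≠ 0)
    (hker : ∀ a, f a = 0 → 0 ≤ ∑ j, w j * (1 / (x j - a) - 1 / (y j - a)).re)
    (S : Finset ℂ) (hS : ∀ a ∈ S, f a = 0) :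
    ∑ a ∈ S, ∑ j, w j * (1 / (x j - a) - 1 / (y j - a)).re ≤
      ∑ j, w j * (logDeriv f (x j) - logDeriv f (y j)).re := by
  set c := ‖p‖ with hc
  have hc0 : 0 ≤ c := norm_nonneg p
  set D := |C| with hD
  let A : ℝ → ℝ := fun R => D * (1 + c + 2 * R) ^ (3 / 2 : ℝ) + |Real.log ‖f p‖| + 1
  have hApos : ∀ R, 0 < R → 0 < A R := by intro R hR; simp only [A]; positivity
  have hbound : ∀ R, 0 < R → ∀ z ∈ closedBall p (2 * R), ‖f z‖ ≤ Real.exp (A R) * ‖f p‖ := by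
    intro R hR z hz
    have hz1 : ‖z‖ ≤ c + 2 * R := by
      have : ‖z - p‖ ≤ 2 * R := by simpa [dist_eq_norm] using hz
      have := norm_sub_norm_le z p
      linarith
    have hfp : 0 < ‖f p‖ := norm_pos_iff.2 hp
    calc ‖f z‖ ≤ Real.exp (C * (1 + ‖z‖) ^ (3 / 2 : ℝ)) := hC z
      _ ≤ Real.exp (A R + Real.log ‖f p‖) := by
        apply Real.exp_le_exp.2
        have h1 : C * (1 + ‖z‖) ^ (3 / 2 : ℝ) ≤ D * (1 + c + 2 * R) ^ (3 / 2 : ℝ) := by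
          refine mul_le_mul (le_abs_self C) ?_ (by positivity) (abs_nonneg C)
          exact Real.rpow_le_rpow (by positivity) (by linarith) (by norm_num)
        have := neg_abs_le (Real.log ‖f p‖)
        simp only [A]; linarith
      _ = _ := by rw [Real.exp_add, Real.exp_log hfp]
  have hAlim : Tendsto (fun R => 64 * A R / R ^ 2) atTop (𝓝 0) := by
    have h1 : ∀ᶠ R : ℝ in atTop,
        (1 + c + 2 * R) ^ (3 / 2 : ℝ) ≤ 3 ^ (3 / 2 : ℝ) * R ^ (3 / 2 : ℝ) := by
      filter_upwards [eventually_ge_atTop (1 + c)] with R hR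
      have : 0 ≤ R := by linarith
      rw [← Real.mul_rpow (by norm_num) this]
      gcongr
      linarith
    have h2 : Tendsto (fun R : ℝ => 64 * (D * 3 ^ (3 / 2 : ℝ)) * R ^ (-(1 / 2) : ℝ) +
        64 * (|Real.log ‖f p‖| + 1) * (R ^ 2)⁻¹) atTop (𝓝 0) := by
      have a1 := (tendsto_rpow_neg_atTop (show (0 : ℝ) < 1 / 2 by norm_num)).const_mul
        (64 * (D * 3 ^ (3 / 2 : ℝ)))
      have a2 := (tendsto_inv_atTop_zero.comp (tendsto_pow_atTop (α := ℝ) two_ne_zero)).const_mul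
        (64 * (|Real.log ‖f p‖| + 1))
      simpa using a1.add a2
    refine squeeze_zero' ?_ ?_ h2
    · filter_upwards [eventually_gt_atTop 0] with R hR
      have := hApos R hR
      positivity
    · filter_upwards [h1, eventually_gt_atTop 0] with R hR hR0
      have e : R ^ (3 / 2 : ℝ) = R ^ (-(1 / 2) : ℝ) * R ^ 2 := by
        rw [← Real.rpow_natCast, ← Real.rpow_add hR0]; norm_num
      rw [div_le_iff₀ (by positivity)]
      have : D * (1 + c + 2 * R) ^ (3 / 2 : ℝ) ≤ D * (3 ^ (3 / 2 : ℝ) * R ^ (3 / 2 : ℝ)) := by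
        gcongr
      rw [e] at this
      simp only [A]
      have e2 : (R ^ 2)⁻¹ * R ^ 2 = 1 := by field_simp
      have e3 : 64 * (|Real.log ‖f p‖| + 1) * (R ^ 2)⁻¹ * R ^ 2 =
          64 * (|Real.log ‖f p‖| + 1) := by rw [mul_assoc, e2, mul_one]
      rw [add_mul, e3]
      linarith
  have hlim : Tendsto (fun R => ∑ j, w j * (logDeriv f (x j) - logDeriv f (y j)).re +
      ∑ j, |w j| * (64 * A R / R ^ 2 * ‖x j - y j‖)) atTop
      (𝓝 (∑ j, w j * (logDeriv f (x j) - logDeriv f (y j)).re)) := by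
    have : Tendsto (fun R => ∑ j, |w j| * (64 * A R / R ^ 2 * ‖x j - y j‖)) atTop
        (𝓝 (∑ j, |w j| * (0 * ‖x j - y j‖))) :=
      tendsto_finsetSum _ fun j _ => (hAlim.mul_const _).const_mul _
    simpa using this.const_add (∑ j, w j * (logDeriv f (x j) - logDeriv f (y j)).re)
  refine ge_of_tendsto hlim ?_
  have hev : ∀ q : ℂ, ∀ᶠ R : ℝ in atTop, q ∈ ball p (R / 4) := by
    intro q
    filter_upwards [eventually_gt_atTop (4 * dist q p)] with R hR
    rw [mem_ball]; linarith
  filter_upwards [eventually_gt_atTop 0, eventually_all.2 fun j => hev (x j),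
    eventually_all.2 fun j => hev (y j), (Finset.eventually_all S).2 fun a _ => hev a]
    with R hR hxR hyR hSR
  obtain ⟨s, hs0, hsR, hs⟩ := exists_multiset_logDeriv_sub hf hR (hApos R hR) hp (hbound R hR)
  have hle : S.val ≤ s := by
    rw [Multiset.le_iff_subset S.nodup]
    intro a ha
    refine hsR a (ball_subset_closedBall (ball_subset_ball (by linarith) (hSR a ha))) (hS a ha)
  obtain ⟨t, rfl⟩ := Multiset.le_iff_exists_add.1 hle
  set k : ℂ → ℝ := fun a => ∑ j, w j * (1 / (x j - a) - 1 / (y j - a)).re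
  have hk : ∀ u : Multiset ℂ, (u.map k).sum =
      ∑ j, w j * ((u.map fun a => 1 / (x j - a) - 1 / (y j - a)).sum).re := by
    intro u
    induction u using Multiset.induction_on with
    | empty => simp
    | cons a u ih =>
      simp only [Multiset.map_cons, Multiset.sum_cons, ih, add_re, mul_add, Finset.sum_add_distrib,
        k]
  have h1 : ∑ a ∈ S, k a ≤ ((S.val + t).map k).sum := by
    rw [Multiset.map_add, Multiset.sum_add]
    refine le_add_of_nonneg_right (Multiset.sum_nonneg ?_)
    intro b hb
    obtain ⟨a, ha, rfl⟩ := Multiset.mem_map.1 hb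
    exact hker a (hs0 a (Multiset.mem_add.2 (Or.inr ha)))
  refine h1.trans ?_
  rw [hk, ← Finset.sum_add_distrib]
  refine Finset.sum_le_sum fun j _ => ?_
  have h2 := hs (x j) (hxR j) (y j) (hyR j) (hx j) (hy j)
  have h3 := (abs_re_le_norm _).trans h2
  rw [sub_re (logDeriv f (x j) - logDeriv f (y j))] at h3
  have h4 := mul_le_mul_of_nonneg_left h3 (abs_nonneg (w j))
  rw [← abs_mul] at h4
  have h5 := (abs_le.1 h4).1
  linarith

open MeasureTheory Set in
lemma exists_norm_mellin_le {f : ℝ → ℂ} {a b : ℝ} (ha : MellinConvergent f a)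
    (hb : MellinConvergent f b) :
    ∃ M, ∀ s : ℂ, a ≤ s.re → s.re ≤ b → ‖mellin f s‖ ≤ M := by
  refine ⟨∫ t in Ioi (0 : ℝ), (‖(t : ℂ) ^ ((a : ℂ) - 1) • f t‖ + ‖(t : ℂ) ^ ((b : ℂ) - 1) • f t‖),
    fun s hsa hsb => ?_⟩
  refine norm_integral_le_of_norm_le (ha.norm.add hb.norm) ?_
  filter_upwards [ae_restrict_mem measurableSet_Ioi] with t (ht : 0 < t)
  simp only [norm_smul]
  rw [← add_mul, norm_cpow_eq_rpow_re_of_pos ht, norm_cpow_eq_rpow_re_of_pos ht,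
    norm_cpow_eq_rpow_re_of_pos ht]
  refine mul_le_mul_of_nonneg_right ?_ (norm_nonneg _)
  simp only [sub_re, ofReal_re, one_re]
  rcases le_total t 1 with h | h
  · exact (Real.rpow_le_rpow_of_exponent_ge ht h (by linarith)).trans
      (le_add_of_nonneg_right (by positivity))
  · exact (Real.rpow_le_rpow_of_exponent_le h (by linarith)).trans
      (le_add_of_nonneg_left (by positivity))

lemma IsStrongFEPair.exists_norm_Λ_le {P : WeakFEPair ℂ} (hP : IsStrongFEPair P) (a b : ℝ) :
    ∃ M, ∀ s : ℂ, a ≤ s.re → s.re ≤ b → ‖P.Λ s‖ ≤ M := by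
  rw [hP.Λ_eq]
  exact exists_norm_mellin_le (hP.hasMellin a).1 (hP.hasMellin b).1

lemma WeakFEPair.exists_norm_Λ₀_le (P : WeakFEPair ℂ) (a b : ℝ) :
    ∃ M, ∀ s : ℂ, a ≤ s.re → s.re ≤ b → ‖P.Λ₀ s‖ ≤ M :=
  exists_norm_mellin_le (P.isStrongFEPair_toStrongFEPair.hasMellin a).1
    (P.isStrongFEPair_toStrongFEPair.hasMellin b).1

open HurwitzZeta in
lemma exists_norm_completedHurwitzZetaEven₀_le (x : UnitAddCircle) (a b : ℝ) :
    ∃ M, ∀ s : ℂ, a ≤ s.re → s.re ≤ b → ‖completedHurwitzZetaEven₀ x s‖ ≤ M := by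
  obtain ⟨M, hM⟩ := (hurwitzEvenFEPair x).exists_norm_Λ₀_le (a / 2) (b / 2)
  refine ⟨M / 2, fun s ha hb => ?_⟩
  have := hM (s / 2) (by simp; linarith) (by simp; linarith)
  rw [completedHurwitzZetaEven₀, norm_div, Complex.norm_two]
  linarith

open HurwitzZeta in
lemma exists_norm_completedHurwitzZetaOdd_le (x : UnitAddCircle) (a b : ℝ) :
    ∃ M, ∀ s : ℂ, a ≤ s.re → s.re ≤ b → ‖completedHurwitzZetaOdd x s‖ ≤ M := by
  obtain ⟨M, hM⟩ := (isStrong_hurwitzOddFEPair x).exists_norm_Λ_le ((a + 1) / 2) ((b + 1) / 2)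
  refine ⟨M / 2, fun s ha hb => ?_⟩
  have := hM ((s + 1) / 2) (by simp; linarith) (by simp; linarith)
  rw [completedHurwitzZetaOdd, norm_div, Complex.norm_two]
  linarith

lemma ZMod.exists_norm_completedLFunction₀_le {N : ℕ} [NeZero N] (Φ : ZMod N → ℂ) (a b : ℝ) :
    ∃ M, ∀ s : ℂ, a ≤ s.re → s.re ≤ b → ‖ZMod.completedLFunction₀ Φ s‖ ≤ M := by
  choose E hE using fun j : ZMod N => exists_norm_completedHurwitzZetaEven₀_le (toAddCircle j) a b
  choose O hO using fun j : ZMod N => exists_norm_completedHurwitzZetaOdd_le (toAddCircle j) a b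
  refine ⟨(N : ℝ) ^ (-a) * ∑ j, ‖Φ j‖ * E j + (N : ℝ) ^ (-a) * ∑ j, ‖Φ j‖ * O j,
    fun s ha hb => ?_⟩
  have hN : (1 : ℝ) ≤ N := by exact_mod_cast NeZero.one_le
  have hNs : ‖(N : ℂ) ^ (-s)‖ ≤ (N : ℝ) ^ (-a) := by
    rw [norm_natCast_cpow_of_pos (Nat.pos_of_neZero N)]
    exact Real.rpow_le_rpow_of_exponent_le hN (by simpa using ha)
  rw [ZMod.completedLFunction₀]
  refine (norm_add_le _ _).trans (add_le_add ?_ ?_) <;> rw [norm_mul] <;>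
    refine mul_le_mul hNs ((norm_sum_le _ _).trans (Finset.sum_le_sum fun j _ => ?_))
      (norm_nonneg _) (by positivity) <;> rw [norm_mul]
  · exact mul_le_mul_of_nonneg_left (hE j s ha hb) (norm_nonneg _)
  · exact mul_le_mul_of_nonneg_left (hO j s ha hb) (norm_nonneg _)

/-- Growth of order at most `3 / 2` on a set. -/
def GrowthOn (f : ℂ → ℂ) (U : Set ℂ) : Prop :=
  ∃ C, 0 ≤ C ∧ ∀ z ∈ U, ‖f z‖ ≤ Real.exp (C * (1 + ‖z‖) ^ (3 / 2 : ℝ))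

namespace GrowthOn

lemma one_le_rpow (z : ℂ) : 1 + ‖z‖ ≤ (1 + ‖z‖) ^ (3 / 2 : ℝ) :=
  Real.self_le_rpow_of_one_le (by linarith [norm_nonneg z]) (by norm_num)

variable {f g : ℂ → ℂ} {U V : Set ℂ}

lemma union (hf : GrowthOn f U) (hg : GrowthOn f V) : GrowthOn f (U ∪ V) := by
  obtain ⟨C, hC0, hC⟩ := hf
  obtain ⟨D, hD0, hD⟩ := hg
  refine ⟨C + D, by positivity, fun z hz => ?_⟩
  have h0 : 0 ≤ (1 + ‖z‖) ^ (3 / 2 : ℝ) := by positivity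
  rcases hz with hz | hz
  · exact (hC z hz).trans (Real.exp_le_exp.2 (by nlinarith))
  · exact (hD z hz).trans (Real.exp_le_exp.2 (by nlinarith))

lemma mul (hf : GrowthOn f U) (hg : GrowthOn g U) : GrowthOn (fun z => f z * g z) U := by
  obtain ⟨C, hC0, hC⟩ := hf
  obtain ⟨D, hD0, hD⟩ := hg
  refine ⟨C + D, by positivity, fun z hz => ?_⟩
  rw [norm_mul, add_mul, Real.exp_add]
  exact mul_le_mul (hC z hz) (hD z hz) (norm_nonneg _) (Real.exp_pos _).le

lemma of_linear {a b : ℝ} (h : ∀ z ∈ U, ‖f z‖ ≤ Real.exp (a + b * ‖z‖)) : GrowthOn f U := by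
  refine ⟨|a| + |b|, by positivity, fun z hz => (h z hz).trans (Real.exp_le_exp.2 ?_)⟩
  have h1 := one_le_rpow z
  have h2 := norm_nonneg z
  calc a + b * ‖z‖ ≤ |a| + |b| * ‖z‖ := by gcongr <;> exact le_abs_self _
    _ ≤ (|a| + |b|) * (1 + ‖z‖) := by nlinarith [abs_nonneg a, abs_nonneg b]
    _ ≤ _ := by gcongr

lemma of_bound {M : ℝ} (h : ∀ z ∈ U, ‖f z‖ ≤ M) : GrowthOn f U := by
  refine of_linear (a := M) (b := 0) fun z hz => (h z hz).trans ?_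
  have := Real.add_one_le_exp M
  simp; linarith

lemma add (hf : GrowthOn f U) (hg : GrowthOn g U) : GrowthOn (fun z => f z + g z) U := by
  obtain ⟨C, hC0, hC⟩ := hf
  obtain ⟨D, hD0, hD⟩ := hg
  refine ⟨C + D + 1, by positivity, fun z hz => (norm_add_le _ _).trans ?_⟩
  have h0 : 0 ≤ (1 + ‖z‖) ^ (3 / 2 : ℝ) := by positivity
  have h1 := one_le_rpow z
  have h2 := norm_nonneg z
  set t := (1 + ‖z‖) ^ (3 / 2 : ℝ)
  have e1 : Real.exp (C * t) ≤ Real.exp ((C + D) * t) := Real.exp_le_exp.2 (by nlinarith)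
  have e2 : Real.exp (D * t) ≤ Real.exp ((C + D) * t) := Real.exp_le_exp.2 (by nlinarith)
  have e3 : 2 ≤ Real.exp t := by linarith [Real.add_one_le_exp t]
  rw [add_mul (C + D), Real.exp_add, one_mul]
  nlinarith [hC z hz, hD z hz, Real.exp_pos ((C + D) * t)]

lemma comp {h : ℂ → ℂ} (hf : GrowthOn f U) (hh : ∀ z, ‖h z‖ ≤ 1 + ‖z‖) :
    GrowthOn (fun z => f (h z)) {z | h z ∈ U} := by
  obtain ⟨C, hC0, hC⟩ := hf
  refine ⟨C * 2 ^ (3 / 2 : ℝ), by positivity, fun z hz => (hC _ hz).trans (Real.exp_le_exp.2 ?_)⟩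
  rw [mul_assoc, ← Real.mul_rpow (by norm_num) (by positivity)]
  gcongr
  linarith [hh z, norm_nonneg z]

lemma mono (hf : GrowthOn f U) (h : V ⊆ U) : GrowthOn f V := by
  obtain ⟨C, hC0, hC⟩ := hf
  exact ⟨C, hC0, fun z hz => hC z (h hz)⟩

lemma congr (hf : GrowthOn f U) (h : ∀ z ∈ U, g z = f z) : GrowthOn g U := by
  obtain ⟨C, hC0, hC⟩ := hf
  exact ⟨C, hC0, fun z hz => by rw [h z hz]; exact hC z hz⟩

lemma natCast_cpow {N : ℕ} (hN : 0 < N) (c : ℂ) (U : Set ℂ) :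
    GrowthOn (fun z => (N : ℂ) ^ (c - z)) U := by
  refine of_linear (a := Real.log N * |c.re|) (b := Real.log N) fun z _ => ?_
  have hN' : (1 : ℝ) ≤ N := by exact_mod_cast hN
  rw [norm_natCast_cpow_of_pos hN, Real.rpow_def_of_pos (by positivity)]
  apply Real.exp_le_exp.2
  rw [← mul_add]
  have := abs_le.1 (abs_re_le_norm z)
  have := le_abs_self c.re
  refine mul_le_mul_of_nonneg_left ?_ (Real.log_nonneg hN')
  rw [sub_re]; linarith

lemma id (U : Set ℂ) : GrowthOn (fun z => z) U := by
  refine of_linear (a := 0) (b := 1) fun z _ => ?_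
  simpa using (by linarith [Real.add_one_le_exp ‖z‖] : ‖z‖ ≤ Real.exp ‖z‖)

end GrowthOn

lemma Real.Gamma_le_exp {x : ℝ} (hx : 2 ≤ x) : Real.Gamma x ≤
    Real.exp (2 * (x + 1) ^ (3 / 2 : ℝ)) := by
  set n := ⌈x⌉₊ with hn
  have hxn : x ≤ n := Nat.le_ceil x
  have hnx : (n : ℝ) ≤ x + 1 := (Nat.ceil_lt_add_one (by linarith)).le
  have hn0 : (0 : ℝ) < n := by linarith
  calc Real.Gamma x ≤ Real.Gamma (n + 1) :=
        Real.Gamma_strictMonoOn_Ici.monotoneOn hx (by simp; linarith) (by linarith)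
    _ = (n.factorial : ℝ) := Real.Gamma_nat_eq_factorial n
    _ ≤ (n : ℝ) ^ n := by exact_mod_cast Nat.factorial_le_pow n
    _ = Real.exp (Real.log n * n) := by
        rw [← Real.rpow_natCast, Real.rpow_def_of_pos hn0]
    _ ≤ _ := by
        apply Real.exp_le_exp.2
        have h1 : Real.log n ≤ (n : ℝ) ^ (1 / 2 : ℝ) / (1 / 2) :=
          Real.log_le_rpow_div hn0.le (by norm_num)
        have h2 : (n : ℝ) ^ (3 / 2 : ℝ) = (n : ℝ) ^ (1 / 2 : ℝ) * n := by
          rw [← Real.rpow_add_one hn0.ne']; norm_num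
        calc Real.log n * n ≤ (n : ℝ) ^ (1 / 2 : ℝ) / (1 / 2) * n := by gcongr
          _ = 2 * (n : ℝ) ^ (3 / 2 : ℝ) := by rw [h2]; ring
          _ ≤ _ := by gcongr

open MeasureTheory Set in
lemma Complex.norm_Gamma_le_Gamma_re {s : ℂ} (hs : 0 < s.re) : ‖Gamma s‖ ≤ Real.Gamma s.re := by
  rw [Gamma_eq_integral hs, Real.Gamma_eq_integral hs, GammaIntegral]
  refine norm_integral_le_of_norm_le (Real.GammaIntegral_convergent hs) ?_
  filter_upwards [ae_restrict_mem measurableSet_Ioi] with x (hx : 0 < x)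
  rw [norm_mul, norm_cpow_eq_rpow_re_of_pos hx, norm_real, Real.norm_of_nonneg (Real.exp_pos _).le]
  simp

lemma GrowthOn.Gammaℝ : GrowthOn Gammaℝ {s | 4 ≤ s.re} := by
  refine ⟨2, by norm_num, fun s (hs : 4 ≤ s.re) => ?_⟩
  rw [Complex.Gammaℝ_def, norm_mul]
  have h1 : ‖(π : ℂ) ^ (-s / 2)‖ ≤ 1 := by
    rw [norm_cpow_eq_rpow_re_of_pos Real.pi_pos]
    refine Real.rpow_le_one_of_one_le_of_nonpos (by linarith [Real.pi_gt_three]) ?_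
    simp; linarith
  have h2 : ‖Complex.Gamma (s / 2)‖ ≤ Real.Gamma (s.re / 2) := by
    have := Complex.norm_Gamma_le_Gamma_re (s := s / 2) (by simp; linarith)
    simpa using this
  have h3 := Real.Gamma_le_exp (x := s.re / 2) (by linarith)
  have h4 : (s.re / 2 + 1) ^ (3 / 2 : ℝ) ≤ (1 + ‖s‖) ^ (3 / 2 : ℝ) := by
    have := (le_abs_self _).trans (abs_re_le_norm s)
    exact Real.rpow_le_rpow (by linarith) (by linarith) (by norm_num)
  calc _ ≤ 1 * Real.Gamma (s.re / 2) := mul_le_mul h1 h2 (norm_nonneg _) (by norm_num)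
    _ ≤ _ := by rw [one_mul]; exact h3.trans (Real.exp_le_exp.2 (by linarith))

namespace DirichletCharacter

lemma exists_norm_LFunction_le {N : ℕ} [NeZero N] (χ : DirichletCharacter ℂ N) :
    ∃ M, ∀ s : ℂ, 2 ≤ s.re → ‖LFunction χ s‖ ≤ M := by
  have hs2 : LSeriesSummable (χ ·) 2 := LSeriesSummable_of_one_lt_re χ (by norm_num)
  refine ⟨∑' n, ‖LSeries.term (χ ·) 2 n‖, fun s hs => ?_⟩
  have hs1 : 1 < s.re := by linarith
  rw [LFunction_eq_LSeries χ hs1, LSeries]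
  have hsum : LSeriesSummable (χ ·) s := LSeriesSummable_of_one_lt_re χ hs1
  refine (norm_tsum_le_tsum_norm hsum.norm).trans (hsum.norm.tsum_le_tsum (fun n => ?_) hs2.norm)
  exact LSeries.norm_term_le_of_re_le_re _ (by simpa using hs) n

lemma gammaFactor_ne_zero {N : ℕ} (χ : DirichletCharacter ℂ N) {s : ℂ} (hs : 0 < s.re) :
    gammaFactor χ s ≠ 0 := by
  rcases χ.even_or_odd with h | h <;> rw [h.gammaFactor_def] <;>
    apply Gammaℝ_ne_zero_of_re_pos
  · exact hs
  · simp; linarith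

lemma completedLFunction_eq_gammaFactor_mul {N : ℕ} [NeZero N] (χ : DirichletCharacter ℂ N) {s : ℂ}
    (hs : 0 < s.re) : completedLFunction χ s = gammaFactor χ s * LFunction χ s := by
  have h0 : s ≠ 0 := by rintro rfl; simp at hs
  rw [LFunction_eq_completed_div_gammaFactor χ s (Or.inl h0),
    mul_div_cancel₀ _ (gammaFactor_ne_zero χ hs)]

lemma growthOn_completedLFunction_right {N : ℕ} [NeZero N] (χ : DirichletCharacter ℂ N) :
    GrowthOn (completedLFunction χ) {s | 4 ≤ s.re} := by
  obtain ⟨M, hM⟩ := exists_norm_LFunction_le χ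
  have hL : GrowthOn (LFunction χ) {s | 4 ≤ s.re} :=
    .of_bound (M := M) fun s (hs : 4 ≤ s.re) => hM s (by linarith)
  have hγ : GrowthOn (gammaFactor χ) {s | 4 ≤ s.re} := by
    rcases χ.even_or_odd with h | h
    · rw [funext h.gammaFactor_def]; exact GrowthOn.Gammaℝ
    · rw [funext h.gammaFactor_def]
      refine (GrowthOn.Gammaℝ.comp (h := fun s => s + 1) fun z => ?_).mono fun s hs => ?_
      · have := norm_add_le z 1
        rw [norm_one] at this; linarith
      · have : 4 ≤ s.re := hs
        simp; linarith
  exact (hγ.mul hL).congr fun s (hs : 4 ≤ s.re) =>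
    completedLFunction_eq_gammaFactor_mul χ (by linarith)

lemma growth_completedLFunction {N : ℕ} [NeZero N] {χ : DirichletCharacter ℂ N} (hχ : χ ≠ 1)
    (hp : χ.IsPrimitive) : GrowthOn (completedLFunction χ) Set.univ := by
  have hmid : GrowthOn (completedLFunction χ) {s | -3 ≤ s.re ∧ s.re ≤ 4} := by
    obtain ⟨M, hM⟩ := ZMod.exists_norm_completedLFunction₀_le χ (-3) 4
    refine .of_bound (M := M) fun s hs => ?_
    have hN : N ≠ 1 := hχ ∘ level_one' _
    rw [completedLFunction, ZMod.completedLFunction_eq, χ.map_zero' hN,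
      χ.sum_eq_zero_of_ne_one hχ]
    simpa using hM s hs.1 hs.2
  have hleft : GrowthOn (completedLFunction χ) {s | s.re ≤ -3} := by
    have h1 := ((growthOn_completedLFunction_right χ⁻¹).comp (h := fun s => 1 - s)
      fun z => by simpa using norm_sub_le 1 z).mono (V := {s | s.re ≤ -3}) fun s hs => by
        have : s.re ≤ -3 := hs
        simp; linarith
    have h2 := (GrowthOn.natCast_cpow (Nat.pos_of_neZero N) (1 / 2) {s | s.re ≤ -3}).mul
      (GrowthOn.of_bound (f := fun _ => rootNumber χ) (M := ‖rootNumber χ‖) fun _ _ => le_rfl)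
    refine (h2.mul h1).congr fun s _ => ?_
    have := hp.completedLFunction_one_sub (1 - s)
    rw [sub_sub_cancel] at this
    rw [this]
    ring_nf
  refine ((hleft.union hmid).union (growthOn_completedLFunction_right χ)).mono fun s _ => ?_
  simp only [Set.mem_union, Set.mem_ofPred_eq]
  grind

end DirichletCharacter

/-- The Riemann xi function, up to a factor `1 / 2`. -/
noncomputable def riemannXi (s : ℂ) : ℂ := s * (s - 1) * completedRiemannZeta₀ s + 1

lemma differentiable_riemannXi : Differentiable ℂ riemannXi := by
  have := differentiable_completedZeta₀
  unfold riemannXi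
  fun_prop

lemma riemannXi_one_sub (s : ℂ) : riemannXi (1 - s) = riemannXi s := by
  rw [riemannXi, riemannXi, completedRiemannZeta₀_one_sub]; ring

lemma riemannXi_eq {s : ℂ} (h0 : s ≠ 0) (h1 : s ≠ 1) :
    riemannXi s = s * (s - 1) * completedRiemannZeta s := by
  have : 1 - s ≠ 0 := sub_ne_zero.2 h1.symm
  rw [riemannXi, completedRiemannZeta_eq]
  field_simp
  ring

lemma growth_riemannXi : GrowthOn riemannXi Set.univ := by
  have h1 : ∀ U, GrowthOn (fun _ => (1 : ℂ)) U := fun U => .of_bound (M := 1) fun _ _ => by simp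
  have hp : ∀ U, GrowthOn (fun s : ℂ => s * (s - 1)) U := by
    intro U
    refine (GrowthOn.id U).mul (((GrowthOn.id U).add
      (GrowthOn.of_bound (f := fun _ => (-1 : ℂ)) (M := 1) fun _ _ => by simp)).congr fun s _ => ?_)
    ring
  have hmid : GrowthOn riemannXi {s | -3 ≤ s.re ∧ s.re ≤ 4} := by
    obtain ⟨M, hM⟩ := exists_norm_completedHurwitzZetaEven₀_le 0 (-3) 4
    exact ((hp _).mul (.of_bound (f := completedRiemannZeta₀) (M := M)
      fun s hs => hM s hs.1 hs.2)).add (h1 _)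
  have hright : GrowthOn riemannXi {s | 4 ≤ s.re} := by
    have h := DirichletCharacter.growthOn_completedLFunction_right (1 : DirichletCharacter ℂ 1)
    rw [DirichletCharacter.completedLFunction_modOne_eq] at h
    refine ((hp _).mul h).congr fun s (hs : 4 ≤ s.re) => riemannXi_eq ?_ ?_ <;> rintro rfl <;>
      norm_num at hs
  have hleft : GrowthOn riemannXi {s | s.re ≤ -3} := by
    have := (hright.comp (h := fun s => 1 - s)
      fun z => by simpa using norm_sub_le 1 z).mono (V := {s | s.re ≤ -3}) fun s hs => by
        have : s.re ≤ -3 := hs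
        simp; linarith
    exact this.congr fun s _ => (riemannXi_one_sub s).symm
  refine ((hleft.union hmid).union hright).mono fun s _ => ?_
  simp only [Set.mem_union, Set.mem_ofPred_eq]
  grind

namespace DirichletCharacter

lemma gammaFactor_inv {N : ℕ} (χ : DirichletCharacter ℂ N) : gammaFactor χ⁻¹ = gammaFactor χ := by
  have hiff : (χ⁻¹).Even ↔ χ.Even := by
    have h : ∀ ψ : DirichletCharacter ℂ N, ψ.Even → (ψ⁻¹).Even := by
      intro ψ h
      rw [Even, ← MulChar.star_apply' ψ, h, star_one]
    exact ⟨fun h' => by simpa using h _ h', h χ⟩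
  ext s
  rw [gammaFactor, gammaFactor]
  by_cases h : χ.Even
  · rw [if_pos h, if_pos (hiff.2 h)]
  · rw [if_neg h, if_neg (mt hiff.1 h)]

lemma differentiableAt_gammaFactor {N : ℕ} (χ : DirichletCharacter ℂ N) {s : ℂ} (hs : 0 < s.re) :
    DifferentiableAt ℂ (gammaFactor χ) s := by
  have h1 : DifferentiableAt ℂ (fun s => (gammaFactor χ s)⁻¹) s := by
    rcases χ.even_or_odd with h | h
    · rw [funext h.gammaFactor_def]; exact differentiable_Gammaℝ_inv s
    · rw [funext h.gammaFactor_def]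
      exact (differentiable_Gammaℝ_inv.comp (differentiable_id.add_const 1)) s
  have h2 := h1.inv (inv_ne_zero (gammaFactor_ne_zero χ hs))
  rwa [show (fun s => (gammaFactor χ s)⁻¹)⁻¹ = gammaFactor χ from funext fun z => inv_inv _] at h2

open ComplexConjugate

variable {N : ℕ} [NeZero N] {χ : DirichletCharacter ℂ N}

lemma LFunction_inv_conj_of_one_lt_re (χ : DirichletCharacter ℂ N) {s : ℂ} (hs : 1 < s.re) :
    LFunction χ⁻¹ (conj s) = conj (LFunction χ s) := by
  rw [LFunction_eq_LSeries χ hs, LFunction_eq_LSeries χ⁻¹ (by simpa using hs), LSeries, LSeries,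
    Complex.conj_tsum]
  refine tsum_congr fun n => ?_
  rcases eq_or_ne n 0 with rfl | hn
  · simp
  rw [LSeries.term_of_ne_zero hn, LSeries.term_of_ne_zero hn, map_div₀]
  congr 1
  · rw [← MulChar.star_apply' χ]; rfl
  · rw [Complex.cpow_conj]
    · simp
    · rw [Complex.natCast_arg]; exact Real.pi_pos.ne

open Filter Topology in
lemma LFunction_inv_conj (hχ : χ ≠ 1) (s : ℂ) : LFunction χ⁻¹ (conj s) = conj (LFunction χ s) := by
  have h1 : Differentiable ℂ (fun s => conj (LFunction χ (conj s))) := fun s =>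
    ((differentiable_LFunction hχ) (conj s)).conj_conj |> fun h => by simpa [Function.comp_def] using h
  have h2 : Differentiable ℂ (LFunction χ⁻¹) := differentiable_LFunction (by simpa using hχ)
  have h3 : LFunction χ⁻¹ = fun s => conj (LFunction χ (conj s)) := by
    refine AnalyticOnNhd.eq_of_eventuallyEq (z₀ := 2) (fun z _ => h2.analyticAt z)
      (fun z _ => h1.analyticAt z) ?_
    have ho : IsOpen {z : ℂ | 1 < z.re} := isOpen_lt continuous_const continuous_re
    filter_upwards [ho.mem_nhds (show (1 : ℝ) < (2 : ℂ).re by norm_num)] with z hz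
    have hz' : 1 < (conj z).re := by simpa using hz
    rw [← LFunction_inv_conj_of_one_lt_re χ hz', conj_conj]
  rw [h3]; simp

lemma completedLFunction_ne_zero_of_one_le_re (hχ : χ ≠ 1) {s : ℂ} (hs : 1 ≤ s.re) :
    completedLFunction χ s ≠ 0 := by
  rw [completedLFunction_eq_gammaFactor_mul χ (by linarith)]
  exact mul_ne_zero (gammaFactor_ne_zero χ (by linarith))
    (LFunction_ne_zero_of_one_le_re χ (Or.inl hχ) hs)

lemma IsPrimitive.rootNumber_ne_zero (hp : χ.IsPrimitive) (hχ : χ ≠ 1) : rootNumber χ ≠ 0 := by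
  intro h
  have := hp.completedLFunction_one_sub (-1)
  rw [h, mul_zero, zero_mul] at this
  exact completedLFunction_ne_zero_of_one_le_re hχ (by norm_num) this

lemma IsPrimitive.completedLFunction_one_sub_eq_zero_iff (hp : χ.IsPrimitive) (hχ : χ ≠ 1) (s : ℂ) :
    completedLFunction χ (1 - s) = 0 ↔ completedLFunction χ⁻¹ s = 0 := by
  rw [hp.completedLFunction_one_sub, mul_eq_zero, or_iff_right]
  refine mul_ne_zero ?_ (hp.rootNumber_ne_zero hχ)
  rw [Ne, Complex.cpow_eq_zero_iff]
  simp [NeZero.ne N]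

lemma IsPrimitive.completedLFunction_one_sub_ne_zero (hp : χ.IsPrimitive) (hχ : χ ≠ 1) {s : ℂ}
    (hs : 1 ≤ s.re) : completedLFunction χ (1 - s) ≠ 0 := by
  rw [Ne, hp.completedLFunction_one_sub_eq_zero_iff hχ]
  exact completedLFunction_ne_zero_of_one_le_re (by simpa using hχ) hs

lemma IsPrimitive.re_mem_of_completedLFunction_eq_zero (hp : χ.IsPrimitive) (hχ : χ ≠ 1) {s : ℂ}
    (hs : completedLFunction χ s = 0) : 0 ≤ s.re ∧ s.re ≤ 1 := by
  constructor <;> by_contra! h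
  · exact hp.completedLFunction_one_sub_ne_zero hχ (s := 1 - s) (by simp; linarith)
      (by rwa [sub_sub_cancel])
  · exact completedLFunction_ne_zero_of_one_le_re hχ h.le hs

open Filter Topology in
lemma logDeriv_completedLFunction (hχ : χ ≠ 1) {s : ℂ} (hs : 1 ≤ s.re) :
    logDeriv (completedLFunction χ) s = logDeriv (gammaFactor χ) s + logDeriv (LFunction χ) s := by
  have ho : IsOpen {z : ℂ | 0 < z.re} := isOpen_lt continuous_const continuous_re
  have h0 : 0 < s.re := by linarith
  have he : completedLFunction χ =ᶠ[𝓝 s] fun s => gammaFactor χ s * LFunction χ s := by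
    filter_upwards [ho.mem_nhds h0] with z hz using completedLFunction_eq_gammaFactor_mul χ hz
  rw [(logDeriv_congr_nhds he).eq_of_nhds, logDeriv_mul s (gammaFactor_ne_zero χ h0)
    (LFunction_ne_zero_of_one_le_re χ (Or.inl hχ) hs) (differentiableAt_gammaFactor χ h0)
    (differentiable_LFunction hχ s)]

lemma logDeriv_LFunction_inv_conj (hχ : χ ≠ 1) (s : ℂ) :
    logDeriv (LFunction χ⁻¹) (conj s) = conj (logDeriv (LFunction χ) s) := by
  have h : LFunction χ⁻¹ = conj ∘ LFunction χ ∘ conj := by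
    ext z
    have := LFunction_inv_conj hχ (conj z)
    simpa using this
  rw [logDeriv_apply, logDeriv_apply, LFunction_inv_conj hχ, map_div₀]
  congr 1
  rw [h, deriv_conj_conj]
  simp

lemma re_logDeriv_LFunction_inv (hχ : χ ≠ 1) (σ : ℝ) :
    (logDeriv (LFunction χ⁻¹) σ).re = (logDeriv (LFunction χ) σ).re := by
  have := logDeriv_LFunction_inv_conj hχ (σ : ℂ)
  rw [conj_ofReal] at this
  rw [this, conj_re]

lemma IsPrimitive.logDeriv_completedLFunction_one_sub (hp : χ.IsPrimitive) (hχ : χ ≠ 1) {s : ℂ}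
    (hs : 1 ≤ s.re) : logDeriv (completedLFunction χ) (1 - s) =
      -(Real.log N : ℂ) - logDeriv (completedLFunction χ⁻¹) s := by
  have hN : (N : ℂ) ≠ 0 := NeZero.ne _
  have h1 : logDeriv (fun s => completedLFunction χ (1 - s)) s =
      -logDeriv (completedLFunction χ) (1 - s) := by
    rw [logDeriv_apply, logDeriv_apply, deriv_comp_const_sub, neg_div]
  have h2 : (fun s => completedLFunction χ (1 - s)) =
      fun s => (N : ℂ) ^ (s - 1 / 2) * rootNumber χ * completedLFunction χ⁻¹ s :=
    funext hp.completedLFunction_one_sub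
  have hd : HasDerivAt (fun s : ℂ => (N : ℂ) ^ (s - 1 / 2))
      ((N : ℂ) ^ (s - 1 / 2) * Complex.log N * 1) s :=
    ((hasDerivAt_id s).sub_const (1 / 2 : ℂ)).const_cpow (Or.inl hN)
  have hNs : (N : ℂ) ^ (s - 1 / 2) ≠ 0 := by simp [hN]
  rw [h2, logDeriv_mul (f := fun s => (N : ℂ) ^ (s - 1 / 2) * rootNumber χ)
    (g := completedLFunction χ⁻¹) s (mul_ne_zero hNs (hp.rootNumber_ne_zero hχ))
    (completedLFunction_ne_zero_of_one_le_re (by simpa using hχ) hs)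
    (hd.differentiableAt.mul_const _) (differentiable_completedLFunction (by simpa using hχ) s),
    logDeriv_mul_const s _ (hp.rootNumber_ne_zero hχ), logDeriv_apply, hd.deriv] at h1
  rw [mul_one, mul_div_cancel_left₀ _ hNs, ← Complex.natCast_log] at h1
  linear_combination h1

lemma IsPrimitive.re_logDeriv_sub (hp : χ.IsPrimitive) (hχ : χ ≠ 1) {σ : ℝ} (hσ : 1 ≤ σ) :
    (logDeriv (completedLFunction χ) σ - logDeriv (completedLFunction χ) (1 - σ)).re =
      Real.log N + 2 * (logDeriv (gammaFactor χ) σ).re + 2 * (logDeriv (LFunction χ) σ).re := by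
  have hσ' : 1 ≤ (σ : ℂ).re := by simpa
  rw [hp.logDeriv_completedLFunction_one_sub hχ hσ', logDeriv_completedLFunction hχ hσ',
    logDeriv_completedLFunction (by simpa using hχ) hσ', gammaFactor_inv]
  simp only [sub_re, neg_re, add_re, ofReal_re, re_logDeriv_LFunction_inv hχ]
  ring

/-- Lower bound for a weighted sum of logarithmic derivatives of the `L`-function of a primitive
character in terms of real zeros, for weights whose associated kernel is nonnegative. -/
theorem IsPrimitive.sum_zeros_le (hp : χ.IsPrimitive) (hχ : χ ≠ 1) {ι : Type*} [Fintype ι]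
    (w σ : ι → ℝ) (hσ : ∀ j, 1 ≤ σ j)
    (hker : ∀ a : ℂ, 0 ≤ a.re → a.re ≤ 1 →
      0 ≤ ∑ j, w j * (1 / (σ j - a) - 1 / (1 - σ j - a)).re)
    (B : Finset ℝ) (hB : ∀ β ∈ B, 1 / 2 < β ∧ β < 1 ∧ LFunction χ β = 0) :
    ∑ β ∈ B, ∑ j, w j * (1 / (σ j - β) + 1 / (σ j - (1 - β))) ≤
      ∑ j, w j * (Real.log N / 2 + (logDeriv (gammaFactor χ) (σ j)).re +
        (logDeriv (LFunction χ) (σ j)).re) := by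
  obtain ⟨C, -, hC⟩ := growth_completedLFunction hχ hp
  have hzero : ∀ β ∈ B, completedLFunction χ (β : ℂ) = 0 ∧ completedLFunction χ (1 - β : ℂ) = 0 := by
    intro β hβ
    obtain ⟨h1, h2, h3⟩ := hB β hβ
    have hre : 0 < (β : ℂ).re := by rw [ofReal_re]; linarith
    refine ⟨by rw [completedLFunction_eq_gammaFactor_mul χ hre, h3, mul_zero], ?_⟩
    rw [hp.completedLFunction_one_sub_eq_zero_iff hχ, completedLFunction_eq_gammaFactor_mul _ hre]
    have := LFunction_inv_conj hχ (β : ℂ)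
    rw [conj_ofReal, h3, map_zero] at this
    rw [this, mul_zero]
  set S₁ : Finset ℂ := B.image fun β : ℝ => (β : ℂ)
  set S₂ : Finset ℂ := B.image fun β : ℝ => (1 - β : ℂ)
  have hdisj : Disjoint S₁ S₂ := by
    rw [Finset.disjoint_left]
    intro a ha ha'
    obtain ⟨b, hb, rfl⟩ := Finset.mem_image.1 ha
    obtain ⟨c, hc, hbc⟩ := Finset.mem_image.1 ha'
    have : 1 - c = b := by exact_mod_cast hbc
    linarith [(hB b hb).1, (hB c hc).1]
  have key := sum_le_sum_re_logDeriv_sub (differentiable_completedLFunction hχ)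
    (fun z => hC z (Set.mem_univ z)) w (fun j => (σ j : ℂ)) (fun j => 1 - (σ j : ℂ))
    (fun j => completedLFunction_ne_zero_of_one_le_re hχ (by simpa using hσ j))
    (fun j => hp.completedLFunction_one_sub_ne_zero hχ (by simpa using hσ j))
    (p := 1) (completedLFunction_ne_zero_of_one_le_re hχ (by simp))
    (fun a ha => by
      obtain ⟨h1, h2⟩ := hp.re_mem_of_completedLFunction_eq_zero hχ ha
      exact hker a h1 h2)
    (S₁ ∪ S₂) (by
      intro a ha
      rcases Finset.mem_union.1 ha with ha | ha <;> obtain ⟨b, hb, rfl⟩ := Finset.mem_image.1 ha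
      exacts [(hzero b hb).1, (hzero b hb).2])
  rw [Finset.sum_union hdisj, Finset.sum_image (by simp), Finset.sum_image (by simp),
    ← Finset.sum_add_distrib] at key
  have hl : ∀ β : ℝ, ∑ j, w j * (1 / ((σ j : ℂ) - β) - 1 / (1 - (σ j : ℂ) - β)).re +
      ∑ j, w j * (1 / ((σ j : ℂ) - (1 - β)) - 1 / (1 - (σ j : ℂ) - (1 - β))).re =
      2 * ∑ j, w j * (1 / (σ j - β) + 1 / (σ j - (1 - β))) := by
    intro β
    rw [← Finset.sum_add_distrib, Finset.mul_sum]
    refine Finset.sum_congr rfl fun j _ => ?_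
    have e1 : (1 / ((σ j : ℂ) - β) - 1 / (1 - (σ j : ℂ) - β)) =
        ((1 / (σ j - β) - 1 / (1 - σ j - β) : ℝ) : ℂ) := by push_cast; ring
    have e2 : (1 / ((σ j : ℂ) - (1 - β)) - 1 / (1 - (σ j : ℂ) - (1 - β))) =
        ((1 / (σ j - (1 - β)) - 1 / (1 - σ j - (1 - β)) : ℝ) : ℂ) := by push_cast; ring
    rw [e1, e2, ofReal_re, ofReal_re]
    have e3 : 1 - σ j - β = -(σ j - (1 - β)) := by ring
    have e4 : 1 - σ j - (1 - β) = -(σ j - β) := by ring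
    rw [e3, e4, one_div_neg_eq_neg_one_div, one_div_neg_eq_neg_one_div]
    ring
  rw [Finset.sum_congr rfl fun β _ => hl β, ← Finset.mul_sum] at key
  have hr : ∑ j, w j * (logDeriv (completedLFunction χ) (σ j) -
      logDeriv (completedLFunction χ) (1 - σ j)).re =
      2 * ∑ j, w j * (Real.log N / 2 + (logDeriv (gammaFactor χ) (σ j)).re +
        (logDeriv (LFunction χ) (σ j)).re) := by
    rw [Finset.mul_sum]
    refine Finset.sum_congr rfl fun j _ => ?_
    rw [hp.re_logDeriv_sub hχ (hσ j)]
    ring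
  rw [hr] at key
  linarith

end DirichletCharacter

lemma hasDerivAt_log_Gamma {x : ℝ} (hx : 0 < x) :
    HasDerivAt (Real.log ∘ Real.Gamma) (digamma x).re x := by
  have h1 : HasDerivAt Gamma (deriv Gamma x) (x : ℂ) := by
    refine (differentiableAt_Gamma _ fun m h => ?_).hasDerivAt
    have : x = -m := by exact_mod_cast h
    have : (0 : ℝ) ≤ m := m.cast_nonneg
    linarith
  have h2 : HasDerivAt Real.Gamma (deriv Gamma x).re x := by
    simpa [Complex.Gamma_ofReal] using h1.real_of_complex
  have h3 := h2.log (Real.Gamma_pos_of_pos hx).ne'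
  rw [digamma_def, logDeriv_apply, Complex.Gamma_ofReal, div_ofReal_re]
  exact h3

lemma re_digamma_mono {x y : ℝ} (hx : 0 < x) (hxy : x ≤ y) : (digamma x).re ≤ (digamma y).re := by
  rw [← (hasDerivAt_log_Gamma hx).deriv, ← (hasDerivAt_log_Gamma (hx.trans_le hxy)).deriv]
  exact Real.convexOn_log_Gamma.monotoneOn_deriv
    (fun z hz => (hasDerivAt_log_Gamma hz).differentiableAt) hx (hx.trans_le hxy) hxy

lemma re_digamma_le_log {x : ℝ} (hx : 0 < x) : (digamma x).re ≤ Real.log x := by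
  have h := Real.convexOn_log_Gamma.le_slope_of_hasDerivAt (x := x) (y := x + 1) hx
    (by simp only [Set.mem_Ioi]; linarith) (by linarith) (hasDerivAt_log_Gamma hx)
  rw [slope_def_field] at h
  simp only [Function.comp_apply, Real.Gamma_add_one hx.ne', add_sub_cancel_left, div_one] at h
  rwa [Real.log_mul hx.ne' (Real.Gamma_pos_of_pos hx).ne', add_sub_cancel_right] at h

lemma logDeriv_Gammaℝ {s : ℂ} (hs : 0 < s.re) :
    logDeriv Gammaℝ s = -(Real.log π / 2 : ℝ) + digamma (s / 2) / 2 := by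
  have hs2 : 0 < (s / 2).re := by simp; linarith
  have hd : DifferentiableAt ℂ Gamma (s / 2) := differentiableAt_Gamma _ fun m h => by
    rw [h] at hs2
    have : (0 : ℝ) ≤ m := m.cast_nonneg
    simp at hs2; linarith
  have hπ : (π : ℂ) ≠ 0 := by simp [Real.pi_ne_zero]
  have h1 : HasDerivAt (fun s : ℂ => (π : ℂ) ^ (-s / 2))
      ((π : ℂ) ^ (-s / 2) * Complex.log π * (-1 / 2)) s :=
    (((hasDerivAt_id s).neg).div_const 2).const_cpow (Or.inl hπ)
  have h2 : HasDerivAt (fun s : ℂ => Gamma (s / 2)) (deriv Gamma (s / 2) * (1 / 2)) s :=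
    HasDerivAt.comp s hd.hasDerivAt ((hasDerivAt_id s).div_const 2)
  have hp : (π : ℂ) ^ (-s / 2) ≠ 0 := by simp [hπ]
  have he : Gammaℝ = fun s : ℂ => (π : ℂ) ^ (-s / 2) * Gamma (s / 2) := funext Gammaℝ_def
  rw [he, logDeriv_mul (f := fun s : ℂ => (π : ℂ) ^ (-s / 2)) (g := fun s : ℂ => Gamma (s / 2)) s hp
    (Gamma_ne_zero_of_re_pos hs2) h1.differentiableAt h2.differentiableAt,
    logDeriv_apply, logDeriv_apply, h1.deriv, h2.deriv, digamma_def, logDeriv_apply,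
    mul_assoc, mul_div_cancel_left₀ _ hp, ← ofReal_log Real.pi_pos.le]
  push_cast
  ring

namespace DirichletCharacter

lemma exists_re_logDeriv_gammaFactor {N : ℕ} (χ : DirichletCharacter ℂ N) :
    ∃ a : ℝ, 0 ≤ a ∧ a ≤ 1 ∧ ∀ σ : ℝ, 0 < σ →
      (logDeriv (gammaFactor χ) σ).re = -(Real.log π / 2) + (digamma ((σ + a) / 2 : ℝ)).re / 2 := by
  have key : ∀ σ : ℝ, 0 < σ →
      (logDeriv Gammaℝ σ).re = -(Real.log π / 2) + (digamma (σ / 2 : ℝ)).re / 2 := by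
    intro σ hσ
    rw [logDeriv_Gammaℝ (by simpa using hσ), add_re, neg_re, ofReal_re]
    norm_num
  rcases χ.even_or_odd with h | h
  · refine ⟨0, le_rfl, zero_le_one, fun σ hσ => ?_⟩
    rw [funext h.gammaFactor_def, add_zero, ← key σ hσ]
  · refine ⟨1, zero_le_one, le_rfl, fun σ hσ => ?_⟩
    rw [funext h.gammaFactor_def, ← key (σ + 1) (by linarith), logDeriv_apply, logDeriv_apply,
      deriv_comp_add_const]
    push_cast
    rfl

lemma re_logDeriv_gammaFactor_mono {N : ℕ} (χ : DirichletCharacter ℂ N) {x y : ℝ} (hx : 0 < x)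
    (hxy : x ≤ y) : (logDeriv (gammaFactor χ) x).re ≤ (logDeriv (gammaFactor χ) y).re := by
  obtain ⟨a, h0, -, h⟩ := exists_re_logDeriv_gammaFactor χ
  rw [h x hx, h y (hx.trans_le hxy)]
  have := re_digamma_mono (x := (x + a) / 2) (y := (y + a) / 2) (by linarith) (by linarith)
  linarith

lemma re_logDeriv_gammaFactor_nonpos {N : ℕ} (χ : DirichletCharacter ℂ N) {x : ℝ} (hx : 0 < x)
    (hx' : x ≤ 5) : (logDeriv (gammaFactor χ) x).re ≤ 0 := by
  obtain ⟨a, h0, h1, h⟩ := exists_re_logDeriv_gammaFactor χ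
  rw [h x hx]
  have h2 : 0 < (x + a) / 2 := by linarith
  have := (re_digamma_le_log h2).trans
    (Real.log_le_log h2 (show (x + a) / 2 ≤ π by linarith [Real.pi_gt_three]))
  linarith

end DirichletCharacter

open scoped ArithmeticFunction.vonMangoldt in
lemma DirichletCharacter.hasSum_vonMangoldt_mul_re {N : ℕ} [NeZero N] (χ : DirichletCharacter ℂ N)
    {σ : ℝ} (hσ : 1 < σ) :
    HasSum (fun n : ℕ => Λ n * (n : ℝ) ^ (-σ) * (χ n).re) (-(logDeriv (LFunction χ) σ).re) := by
  have hs : 1 < (σ : ℂ).re := by simpa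
  have h1 := (LSeriesSummable_twist_vonMangoldt χ hs).LSeriesHasSum
  rw [LSeries_twist_vonMangoldt_eq χ hs, ← deriv_LFunction_eq_deriv_LSeries χ hs,
    ← LFunction_eq_LSeries χ hs, neg_div, ← logDeriv_apply] at h1
  have h2 := Complex.hasSum_re h1
  rw [neg_re] at h2
  refine h2.congr_fun fun n => ?_
  rcases eq_or_ne n 0 with rfl | hn
  · simp
  rw [LSeries.term_of_ne_zero hn, div_eq_mul_inv, ← Complex.cpow_neg, ← ofReal_neg,
    ← ofReal_natCast, ← ofReal_cpow n.cast_nonneg]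
  simp only [Pi.mul_apply, re_mul_ofReal]
  ring

lemma re_logDeriv_riemannZeta_nonpos {σ : ℝ} (hσ : 1 < σ) : (logDeriv riemannZeta σ).re ≤ 0 := by
  have h := (1 : DirichletCharacter ℂ 1).hasSum_vonMangoldt_mul_re hσ
  rw [DirichletCharacter.LFunction_modOne_eq] at h
  refine neg_nonneg.1 (h.nonneg fun n => mul_nonneg (mul_nonneg
    ArithmeticFunction.vonMangoldt_nonneg (by positivity)) ?_)
  simp [Subsingleton.elim (n : ZMod 1) 1]

lemma re_one_div_sub_one_div (σ : ℝ) (a : ℂ) :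
    (1 / (σ - a) - 1 / (1 - σ - a)).re = (σ - a.re) / ((σ - a.re) ^ 2 + a.im ^ 2) +
      (σ - (1 - a.re)) / ((σ - (1 - a.re)) ^ 2 + a.im ^ 2) := by
  rw [sub_re, one_div, one_div, inv_re, inv_re, normSq_apply, normSq_apply]
  simp only [sub_re, ofReal_re, one_re, sub_im, ofReal_im, one_im]
  rw [show 1 - σ - a.re = -(σ - (1 - a.re)) by ring]
  ring

section

open Filter Topology

lemma riemannXi_eq_mul_riemannZeta {s : ℂ} (h0 : s ≠ 0) (h1 : s ≠ 1) (h : 0 < s.re) :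
    riemannXi s = s * (s - 1) * (Gammaℝ s * riemannZeta s) := by
  rw [riemannXi_eq h0 h1, riemannZeta_def_of_ne_zero h0,
    mul_div_cancel₀ _ (Gammaℝ_ne_zero_of_re_pos h)]

lemma riemannXi_ne_zero_of_one_le_re {s : ℂ} (hs : 1 ≤ s.re) : riemannXi s ≠ 0 := by
  rcases eq_or_ne s 1 with rfl | h1
  · simp [riemannXi]
  have h0 : s ≠ 0 := by rintro rfl; norm_num at hs
  have h : 0 < s.re := by linarith
  rw [riemannXi_eq_mul_riemannZeta h0 h1 h]
  exact mul_ne_zero (mul_ne_zero h0 (sub_ne_zero.2 h1))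
    (mul_ne_zero (Gammaℝ_ne_zero_of_re_pos h) (riemannZeta_ne_zero_of_one_le_re hs))

lemma re_mem_of_riemannXi_eq_zero {s : ℂ} (hs : riemannXi s = 0) : 0 ≤ s.re ∧ s.re ≤ 1 := by
  constructor <;> by_contra! h
  · rw [← riemannXi_one_sub] at hs
    exact riemannXi_ne_zero_of_one_le_re (by simp; linarith) hs
  · exact riemannXi_ne_zero_of_one_le_re h.le hs

lemma logDeriv_riemannXi_one_sub (s : ℂ) : logDeriv riemannXi (1 - s) = -logDeriv riemannXi s := by
  have h : (fun s => riemannXi (1 - s)) = riemannXi := funext riemannXi_one_sub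
  have h1 : logDeriv (fun s => riemannXi (1 - s)) s = -logDeriv riemannXi (1 - s) := by
    rw [logDeriv_apply, logDeriv_apply, deriv_comp_const_sub, neg_div]
  rw [h] at h1
  rw [h1, neg_neg]

lemma sum_le_sum_re_logDeriv_riemannXi {ι : Type*} [Fintype ι] (w σ : ι → ℝ) (hσ : ∀ j, 1 ≤ σ j)
    (hker : ∀ a : ℂ, 0 ≤ a.re → a.re ≤ 1 →
      0 ≤ ∑ j, w j * (1 / (σ j - a) - 1 / (1 - σ j - a)).re)
    (S : Finset ℂ) (hS : ∀ a ∈ S, riemannXi a = 0) :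
    ∑ a ∈ S, ∑ j, w j * (1 / (σ j - a) - 1 / (1 - σ j - a)).re ≤
      2 * ∑ j, w j * (logDeriv riemannXi (σ j)).re := by
  obtain ⟨C, -, hC⟩ := growth_riemannXi
  have h0 : ∀ j, riemannXi (σ j) ≠ 0 := fun j => riemannXi_ne_zero_of_one_le_re (by simpa using hσ j)
  have key := sum_le_sum_re_logDeriv_sub differentiable_riemannXi
    (fun z => hC z (Set.mem_univ z)) w (fun j => (σ j : ℂ)) (fun j => 1 - (σ j : ℂ)) h0
    (fun j => by rw [riemannXi_one_sub]; exact h0 j)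
    (p := 1) (riemannXi_ne_zero_of_one_le_re (by simp))
    (fun a ha => hker a (re_mem_of_riemannXi_eq_zero ha).1 (re_mem_of_riemannXi_eq_zero ha).2) S hS
  refine key.trans_eq ?_
  rw [Finset.mul_sum]
  refine Finset.sum_congr rfl fun j _ => ?_
  rw [logDeriv_riemannXi_one_sub, sub_neg_eq_add, add_re]
  ring

lemma logDeriv_riemannXi {s : ℂ} (hs : 1 < s.re) : logDeriv riemannXi s =
    1 / s + 1 / (s - 1) + logDeriv Gammaℝ s + logDeriv riemannZeta s := by
  have ho : IsOpen {z : ℂ | 1 < z.re} := isOpen_lt continuous_const continuous_re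
  have hne : ∀ z : ℂ, 1 < z.re → z ≠ 0 ∧ z ≠ 1 := by
    intro z hz
    constructor <;> rintro rfl <;> norm_num at hz
  have he : riemannXi =ᶠ[𝓝 s] fun s => (s * (s - 1)) * (Gammaℝ s * riemannZeta s) := by
    filter_upwards [ho.mem_nhds hs] with z hz
    exact riemannXi_eq_mul_riemannZeta (hne z hz).1 (hne z hz).2 (by linarith [show 1 < z.re from hz])
  obtain ⟨h0, h1⟩ := hne s hs
  have h1' := sub_ne_zero.2 h1
  have hG : Gammaℝ s ≠ 0 := Gammaℝ_ne_zero_of_re_pos (by linarith)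
  have hζ := riemannZeta_ne_zero_of_one_le_re hs.le
  have hGd : DifferentiableAt ℂ Gammaℝ s := by
    have h2 := (differentiable_Gammaℝ_inv s).inv (inv_ne_zero hG)
    rwa [show (fun s => (Gammaℝ s)⁻¹)⁻¹ = Gammaℝ from funext fun z => inv_inv _] at h2
  have hd := differentiableAt_riemannZeta h1
  rw [(logDeriv_congr_nhds he).eq_of_nhds,
    logDeriv_mul (f := fun s => s * (s - 1)) (g := fun s => Gammaℝ s * riemannZeta s) s
      (mul_ne_zero h0 h1') (mul_ne_zero hG hζ) (by fun_prop) (hGd.mul hd),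
    logDeriv_mul (f := fun s => s) (g := fun s => s - 1) s h0 h1' (by fun_prop) (by fun_prop),
    logDeriv_mul s hG hζ hGd hd, logDeriv_apply, logDeriv_apply, deriv_id'', deriv_sub_const,
    deriv_id'']
  ring

lemma re_logDeriv_riemannXi {σ : ℝ} (hσ : 1 < σ) : (logDeriv riemannXi σ).re =
    1 / (σ - 1) - Real.log π / 2 + (digamma (σ / 2 + 1 : ℝ)).re / 2 + (logDeriv riemannZeta σ).re := by
  rw [logDeriv_riemannXi (by simpa using hσ), logDeriv_Gammaℝ (by simp; linarith)]
  have h := digamma_apply_add_one (σ / 2 : ℂ) (fun m h => by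
    have h' : σ / 2 = -m := by exact_mod_cast h
    have : (0 : ℝ) ≤ m := m.cast_nonneg
    linarith)
  have e1 : ((σ / 2 + 1 : ℝ) : ℂ) = (σ : ℂ) / 2 + 1 := by push_cast; ring
  have e2 : (1 / (σ : ℂ) + 1 / ((σ : ℂ) - 1)) = ((1 / σ + 1 / (σ - 1) : ℝ) : ℂ) := by push_cast; ring
  have e3 : ((σ : ℂ) / 2)⁻¹ = ((2 / σ : ℝ) : ℂ) := by push_cast; rw [inv_div]
  rw [e1, h, e2, e3]
  simp only [add_re, ofReal_re, neg_re, div_ofNat_re]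
  ring

lemma one_lt_log_pi : 1 < Real.log π := by
  rw [Real.lt_log_iff_exp_lt Real.pi_pos]
  linarith [Real.exp_one_lt_d9, Real.pi_gt_d2]

lemma riemannZeta_ne_zero_of_mem_Ioo {β : ℝ} (h : 1 / 2 < β) (h' : β < 1) : riemannZeta β ≠ 0 := by
  intro hz
  have hβ : riemannXi β = 0 := by
    rw [riemannXi_eq_mul_riemannZeta (by exact_mod_cast (by linarith : β ≠ 0))
      (by exact_mod_cast h'.ne) (by simp; linarith), hz]
    simp
  have hβ' : riemannXi (1 - β) = 0 := by rw [riemannXi_one_sub, hβ]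
  have hne : (β : ℂ) ≠ 1 - β := by
    intro h1
    have : β = 1 - β := by exact_mod_cast h1
    linarith
  have key := sum_le_sum_re_logDeriv_riemannXi (ι := Unit) (fun _ => 1) (fun _ => 2)
    (fun _ => by norm_num) (fun a h0 h1 => by
      simp only [re_one_div_sub_one_div, Finset.univ_unique, Finset.sum_singleton, one_mul]
      have : 0 ≤ 2 - a.re := by linarith
      have : 0 ≤ 2 - (1 - a.re) := by linarith
      positivity) {(β : ℂ), 1 - (β : ℂ)} (by simp [hβ, hβ'])
  rw [Finset.sum_pair hne, re_logDeriv_riemannXi one_lt_two] at key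
  simp only [re_one_div_sub_one_div, Finset.univ_unique, Finset.sum_singleton, one_mul] at key
  simp only [ofReal_re, ofReal_im, sub_re, one_re, sub_im, one_im] at key
  have h2 := re_logDeriv_riemannZeta_nonpos one_lt_two
  have h3 := re_digamma_le_log (x := 2 / 2 + 1) (by norm_num)
  have h4 : Real.log (2 / 2 + 1) ≤ 0.7 := by norm_num; linarith [Real.log_two_lt_d9]
  have h5 := one_lt_log_pi
  have e : ∀ x : ℝ, 0 < x → x / (x ^ 2 + 0 ^ 2) = 1 / x := by intro x hx; field_simp; ring
  have e' : ∀ x : ℝ, 0 < x → x / (x ^ 2 + (0 - 0) ^ 2) = 1 / x := by intro x hx; field_simp; ring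
  rw [e _ (by linarith), e _ (by linarith), e' _ (by linarith), e' _ (by linarith),
    show 2 - (1 - (1 - β)) = 2 - β by ring] at key
  have h6 : 4 / 3 ≤ 1 / (2 - β) + 1 / (2 - (1 - β)) := by
    rw [div_add_div _ _ (by linarith) (by linarith), div_le_div_iff₀ (by norm_num) (by nlinarith)]
    nlinarith [sq_nonneg (2 * β - 1)]
  linarith

lemma neg_re_logDeriv_riemannZeta_add_le {ε : ℝ} (h : 0 < ε) (h1 : ε ≤ 1) :
    -(logDeriv riemannZeta (1 + ε : ℝ)).re + (logDeriv riemannZeta (1 + 2 * ε : ℝ)).re / 2 ≤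
      3 / 4 / ε := by
  have hn : ∀ A t : ℝ, ε ≤ A → 0 ≤ t →
      0 ≤ A / (A ^ 2 + t) - 1 / 2 * ((A + ε) / ((A + ε) ^ 2 + t)) := by
    intro A t hA ht
    have hA0 : 0 < A := by linarith
    have : A / (A ^ 2 + t) - 1 / 2 * ((A + ε) / ((A + ε) ^ 2 + t)) =
        (A * (A + ε) * (A + 2 * ε) + t * (A - ε)) / (2 * (A ^ 2 + t) * ((A + ε) ^ 2 + t)) := by
      field_simp; ring
    rw [this]
    have : 0 ≤ A - ε := by linarith
    positivity
  have key := sum_le_sum_re_logDeriv_riemannXi (ι := Fin 2) ![1, -1 / 2] ![1 + ε, 1 + 2 * ε]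
    (fun j => by fin_cases j <;> simp <;> linarith) (fun a h0 h1 => by
      rw [Fin.sum_univ_two]
      simp only [Matrix.cons_val_zero, Matrix.cons_val_one, re_one_div_sub_one_div]
      have k1 := hn (1 + ε - a.re) (a.im ^ 2) (by linarith) (sq_nonneg _)
      have k2 := hn (1 + ε - (1 - a.re)) (a.im ^ 2) (by linarith) (sq_nonneg _)
      rw [show 1 + ε - a.re + ε = 1 + 2 * ε - a.re by ring] at k1
      rw [show 1 + ε - (1 - a.re) + ε = 1 + 2 * ε - (1 - a.re) by ring] at k2
      linarith) ∅ (by simp)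
  rw [Fin.sum_univ_two] at key
  simp only [Finset.sum_empty, Matrix.cons_val_zero, Matrix.cons_val_one] at key
  rw [re_logDeriv_riemannXi (by linarith), re_logDeriv_riemannXi (by linarith)] at key
  have h2 := re_digamma_mono (x := (1 + ε) / 2 + 1) (y := (1 + 2 * ε) / 2 + 1) (by linarith)
    (by linarith)
  have hx : 0 < (1 + ε) / 2 + 1 := by linarith
  have h3 := (re_digamma_le_log hx).trans
    (Real.log_le_log hx (show (1 + ε) / 2 + 1 ≤ π by linarith [Real.pi_gt_three]))
  have e : 3 / 4 / ε = 1 / (1 + ε - 1) - 1 / 2 * (1 / (1 + 2 * ε - 1)) := by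
    rw [add_sub_cancel_left, add_sub_cancel_left]; field_simp; norm_num
  rw [e]
  linarith

end

namespace DirichletCharacter

variable {N : ℕ} [NeZero N]

lemma primitiveCharacter_mul_apply (χ ψ : DirichletCharacter ℂ N) (a : ℤ)
    (hχ : χ.primitiveCharacter a ≠ 0) (hψ : ψ.primitiveCharacter a ≠ 0) :
    (χ * ψ).primitiveCharacter a = χ.primitiveCharacter a * ψ.primitiveCharacter a := by
  rw [Ne, apply_eq_zero_iff, not_not] at hχ hψ
  have hd : χ.conductor * ψ.conductor ∣ χ.conductor * ψ.conductor * N := dvd_mul_right _ _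
  set m := χ.conductor * ψ.conductor * N
  have : NeZero m := ⟨mul_ne_zero (mul_ne_zero χ.conductor_ne_zero ψ.conductor_ne_zero) (NeZero.ne N)⟩
  have h1 := dvd_mul_right χ.conductor ψ.conductor
  have h2 := dvd_mul_left ψ.conductor χ.conductor
  have h3 : (χ * ψ).conductor ∣ χ.conductor * ψ.conductor :=
    (conductor_mul_dvd_lcm_conductor χ ψ).trans (Nat.lcm_dvd h1 h2)
  have hN : N ∣ m := dvd_mul_left _ _
  have key : changeLevel h3 (χ * ψ).primitiveCharacter =
      changeLevel h1 χ.primitiveCharacter * changeLevel h2 ψ.primitiveCharacter := by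
    apply changeLevel_injective hd
    rw [map_mul, ← changeLevel_trans, ← changeLevel_trans, ← changeLevel_trans,
      changeLevel_trans _ (conductor_dvd_level _) hN, changeLevel_trans _ (conductor_dvd_level _) hN,
      changeLevel_trans _ (conductor_dvd_level _) hN, changeLevel_primitiveCharacter,
      changeLevel_primitiveCharacter, changeLevel_primitiveCharacter, map_mul]
  have ha : IsCoprime a (χ.conductor * ψ.conductor : ℕ) := by
    push_cast; exact hχ.mul_right hψ
  rw [← changeLevel_eq_cast_of_dvd' _ h3 ha, ← changeLevel_eq_cast_of_dvd' _ h1 ha,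
    ← changeLevel_eq_cast_of_dvd' _ h2 ha, key, MulChar.mul_apply]

lemma primitiveCharacter_inv_apply (χ : DirichletCharacter ℂ N) (a : ℤ) :
    χ⁻¹.primitiveCharacter a = (starRingEnd ℂ) (χ.primitiveCharacter a) := by
  have h : χ⁻¹.primitiveCharacter a = 0 ↔ χ.primitiveCharacter a = 0 := by
    rw [apply_eq_zero_iff, apply_eq_zero_iff, conductor_inv]
  by_cases h0 : χ.primitiveCharacter a = 0
  · rw [h.2 h0, h0, map_zero]
  have h1 := primitiveCharacter_mul_apply χ χ⁻¹ a h0 (mt h.1 h0)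
  have h2 : (χ * χ⁻¹).primitiveCharacter a = 1 := by
    rw [mul_inv_cancel, primitiveCharacter_one, MulChar.one_apply]
    rw [conductor_one]
    exact isUnit_of_subsingleton _
  rw [h2] at h1
  have hn : ‖χ.primitiveCharacter a‖ = 1 := by
    rw [apply_eq_zero_iff, not_not] at h0
    rw [← ZMod.coe_unitOfIsCoprime _ h0]
    exact χ.primitiveCharacter.unit_norm_eq_one _
  rw [← inv_eq_conj hn]
  exact eq_inv_of_mul_eq_one_right h1.symm

lemma re_primitiveCharacter_combination_nonneg (χ ψ : DirichletCharacter ℂ N) (a : ℤ) :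
    0 ≤ 1 + (χ.primitiveCharacter a).re + (ψ.primitiveCharacter a).re +
      ((χ * ψ).primitiveCharacter a).re / 2 + ((χ * ψ⁻¹).primitiveCharacter a).re / 2 := by
  have hle : ∀ θ : DirichletCharacter ℂ N, -1 ≤ (θ.primitiveCharacter a).re := fun θ => by
    have h1 := θ.primitiveCharacter.norm_le_one (a : ZMod _)
    have h2 := abs_re_le_norm (θ.primitiveCharacter a)
    exact (abs_le.1 (h2.trans h1)).1
  have hinv : ∀ θ : DirichletCharacter ℂ N,
      θ⁻¹.primitiveCharacter a = 0 ↔ θ.primitiveCharacter a = 0 := fun θ => by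
    rw [primitiveCharacter_inv_apply, map_eq_zero]
  -- if exactly one of two characters vanishes at `a`, so does their product
  have hmul : ∀ θ η : DirichletCharacter ℂ N, θ.primitiveCharacter a ≠ 0 →
      η.primitiveCharacter a = 0 → (θ * η).primitiveCharacter a = 0 := by
    intro θ η h1 h2
    by_contra h3
    have h4 := primitiveCharacter_mul_apply (θ * η) θ⁻¹ a h3 (mt (hinv θ).1 h1)
    rw [mul_inv_cancel_comm, h2] at h4
    exact mul_ne_zero h3 (mt (hinv θ).1 h1) h4.symm
  by_cases h1 : χ.primitiveCharacter a = 0 <;> by_cases h2 : ψ.primitiveCharacter a = 0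
  · rw [h1, h2, zero_re]
    linarith [hle (χ * ψ), hle (χ * ψ⁻¹)]
  · rw [mul_comm χ, mul_comm χ, hmul _ _ h2 h1, hmul _ _ (mt (hinv ψ).1 h2) h1, h1, zero_re]
    linarith [hle ψ]
  · rw [hmul _ _ h1 h2, hmul _ _ h1 ((hinv ψ).2 h2), h2, zero_re]
    linarith [hle χ]
  · rw [primitiveCharacter_mul_apply _ _ _ h1 h2,
      primitiveCharacter_mul_apply _ _ _ h1 (mt (hinv ψ).1 h2), primitiveCharacter_inv_apply]
    simp only [mul_re, conj_re, conj_im]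
    nlinarith [mul_nonneg (neg_le_iff_add_nonneg.1 (hle χ)) (neg_le_iff_add_nonneg.1 (hle ψ))]

open scoped ArithmeticFunction.vonMangoldt

lemma hasSum_weighted_vonMangoldt (χ : DirichletCharacter ℂ N) {ι : Type*} [Fintype ι]
    (w σ : ι → ℝ) (hσ : ∀ j, 1 < σ j) :
    HasSum (fun n : ℕ => Λ n * (∑ j, w j * (n : ℝ) ^ (-σ j)) * (χ n).re)
      (-∑ j, w j * (logDeriv (LFunction χ) (σ j)).re) := by
  have := hasSum_sum (s := Finset.univ) fun j _ =>
    (χ.hasSum_vonMangoldt_mul_re (hσ j)).mul_left (w j)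
  simp only [mul_neg, Finset.sum_neg_distrib] at this
  refine this.congr_fun fun n => ?_
  rw [Finset.mul_sum, Finset.sum_mul]
  exact Finset.sum_congr rfl fun j _ => by ring

instance (χ : DirichletCharacter ℂ N) : NeZero χ.conductor := ⟨χ.conductor_ne_zero⟩

lemma hasSum_weighted_vonMangoldt_zeta {ι : Type*} [Fintype ι]
    (w σ : ι → ℝ) (hσ : ∀ j, 1 < σ j) :
    HasSum (fun n : ℕ => Λ n * (∑ j, w j * (n : ℝ) ^ (-σ j)))
      (-∑ j, w j * (logDeriv riemannZeta (σ j)).re) := by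
  have h := (1 : DirichletCharacter ℂ 1).hasSum_weighted_vonMangoldt w σ hσ
  rw [LFunction_modOne_eq] at h
  refine h.congr_fun fun n => ?_
  simp [Subsingleton.elim (n : ZMod 1) 1]

lemma weighted_logDeriv_combination_le (χ ψ : DirichletCharacter ℂ N) {ι : Type*} [Fintype ι]
    (w σ : ι → ℝ) (hσ : ∀ j, 1 < σ j) (hw : ∀ n : ℕ, 1 ≤ n → 0 ≤ ∑ j, w j * (n : ℝ) ^ (-σ j)) :
    ∑ j, w j * (logDeriv riemannZeta (σ j)).re +
      ∑ j, w j * (logDeriv (LFunction χ.primitiveCharacter) (σ j)).re +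
      ∑ j, w j * (logDeriv (LFunction ψ.primitiveCharacter) (σ j)).re +
      (∑ j, w j * (logDeriv (LFunction (χ * ψ).primitiveCharacter) (σ j)).re) / 2 +
      (∑ j, w j * (logDeriv (LFunction (χ * ψ⁻¹).primitiveCharacter) (σ j)).re) / 2 ≤ 0 := by
  have h := ((((hasSum_weighted_vonMangoldt_zeta w σ hσ).add
    (χ.primitiveCharacter.hasSum_weighted_vonMangoldt w σ hσ)).add
    (ψ.primitiveCharacter.hasSum_weighted_vonMangoldt w σ hσ)).add
    (((χ * ψ).primitiveCharacter.hasSum_weighted_vonMangoldt w σ hσ).div_const 2)).add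
    (((χ * ψ⁻¹).primitiveCharacter.hasSum_weighted_vonMangoldt w σ hσ).div_const 2)
  have h0 := h.nonneg fun n => ?_
  · linarith
  rcases Nat.eq_zero_or_pos n with rfl | hn
  · simp
  have := mul_nonneg (mul_nonneg (ArithmeticFunction.vonMangoldt_nonneg (n := n)) (hw n hn))
    (re_primitiveCharacter_combination_nonneg χ ψ n)
  simp only [Int.cast_natCast] at this
  linarith

lemma weighted_logDeriv_le (χ : DirichletCharacter ℂ N) {ι : Type*} [Fintype ι]
    (w σ : ι → ℝ) (hσ : ∀ j, 1 < σ j) (hw : ∀ n : ℕ, 1 ≤ n → 0 ≤ ∑ j, w j * (n : ℝ) ^ (-σ j)) :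
    ∑ j, w j * (logDeriv riemannZeta (σ j)).re +
      ∑ j, w j * (logDeriv (LFunction χ) (σ j)).re ≤ 0 := by
  have h := (hasSum_weighted_vonMangoldt_zeta w σ hσ).add (χ.hasSum_weighted_vonMangoldt w σ hσ)
  have h0 := h.nonneg fun n => ?_
  · linarith
  rcases Nat.eq_zero_or_pos n with rfl | hn
  · simp
  have h1 := (abs_le.1 ((abs_re_le_norm (χ n)).trans (χ.norm_le_one _))).1
  have := mul_nonneg (mul_nonneg (ArithmeticFunction.vonMangoldt_nonneg (n := n)) (hw n hn))
    (neg_le_iff_add_nonneg.1 h1)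
  linarith

lemma LFunction_primitiveCharacter_eq_zero {χ : DirichletCharacter ℂ N} (hχ : χ ≠ 1) {β : ℝ}
    (hβ : 0 < β) (h : LFunction χ β = 0) : LFunction χ.primitiveCharacter β = 0 := by
  have hp : χ.primitiveCharacter ≠ 1 := fun h1 => hχ <| by
    rw [← changeLevel_primitiveCharacter χ, h1, map_one]
  have h1 := LFunction_changeLevel χ.conductor_dvd_level χ.primitiveCharacter (s := β) (.inl hp)
  rw [changeLevel_primitiveCharacter, h, eq_comm, mul_eq_zero] at h1
  refine h1.resolve_right (Finset.prod_ne_zero_iff.2 fun p hp => ?_)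
  have hp := Nat.prime_of_mem_primeFactors hp
  intro h2
  have h3 : ‖χ.primitiveCharacter p * (p : ℂ) ^ (-β : ℂ)‖ < 1 := by
    rw [norm_mul, ← ofReal_neg, Complex.norm_natCast_cpow_of_pos hp.pos, ofReal_re]
    have h4 := χ.primitiveCharacter.norm_le_one (p : ZMod _)
    have h5 : (p : ℝ) ^ (-β) < 1 :=
      Real.rpow_lt_one_of_one_lt_of_neg (by exact_mod_cast hp.one_lt) (by linarith)
    have h6 : 0 ≤ (p : ℝ) ^ (-β) := by positivity
    nlinarith
  rw [← sub_eq_zero.1 h2, norm_one] at h3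
  exact lt_irrefl _ h3

lemma LFunction_one_ne_zero_of_mem_Ioo {β : ℝ} (h : 1 / 2 < β) (h' : β < 1) :
    LFunction (1 : DirichletCharacter ℂ N) β ≠ 0 := by
  rw [← LFunctionTrivChar, LFunctionTrivChar_eq_mul_riemannZeta (by exact_mod_cast h'.ne)]
  refine mul_ne_zero (Finset.prod_ne_zero_iff.2 fun p hp h2 => ?_)
    (riemannZeta_ne_zero_of_mem_Ioo h h')
  have hp := Nat.prime_of_mem_primeFactors hp
  have h3 : ‖(p : ℂ) ^ (-β : ℂ)‖ < 1 := by
    rw [← ofReal_neg, Complex.norm_natCast_cpow_of_pos hp.pos, ofReal_re]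
    exact Real.rpow_lt_one_of_one_lt_of_neg (by exact_mod_cast hp.one_lt) (by linarith)
  rw [← sub_eq_zero.1 h2, norm_one] at h3
  exact lt_irrefl _ h3

end DirichletCharacter

lemma div_add_div_symm {x u t : ℝ} (h1 : x + u ≠ 0 ∨ t ≠ 0) (h2 : x + (1 - u) ≠ 0 ∨ t ≠ 0)
    (ht : 0 ≤ t) :
    (x + u) / ((x + u) ^ 2 + t) + (x + (1 - u)) / ((x + (1 - u)) ^ 2 + t) =
      (1 + 2 * x) * (x + x ^ 2 + (u * (1 - u) + t)) /
        ((x + x ^ 2 + (u * (1 - u) + t)) ^ 2 + t * (1 - 4 * (u * (1 - u)))) := by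
  have hp : ∀ y : ℝ, y ≠ 0 ∨ t ≠ 0 → y ^ 2 + t ≠ 0 := by
    intro y hy
    rcases hy with hy | hy
    · positivity
    · positivity
  rw [div_add_div _ _ (hp _ h1) (hp _ h2)]
  congr 1 <;> ring

/-- Positivity of the kernel underlying the zero-repulsion estimate, in terms of the parameters
`w = t * (1 - 2 * u)²` and `z = t + u * (1 - u) - w`. -/
lemma weighted_kernel_nonneg_aux {e z w : ℝ} (he : 0 < e) (he' : e ≤ 16 / 25) (hz : 0 ≤ z)
    (hw : 0 ≤ w) :
    0 ≤ (1 + 2 * e) * (e + e ^ 2 + (z + w)) / ((e + e ^ 2 + (z + w)) ^ 2 + w)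
      - 1 / 2 * ((1 + 2 * (2 * e)) * (2 * e + (2 * e) ^ 2 + (z + w)) /
        ((2 * e + (2 * e) ^ 2 + (z + w)) ^ 2 + w))
      - 21 / 100 * ((1 + 2 * (2 / 3)) * (2 / 3 + (2 / 3) ^ 2 + (z + w)) /
        ((2 / 3 + (2 / 3) ^ 2 + (z + w)) ^ 2 + w)) := by
  set D₁ := (e + e ^ 2 + (z + w)) ^ 2 + w with hD₁
  set D₂ := (2 * e + (2 * e) ^ 2 + (z + w)) ^ 2 + w with hD₂
  set D₃ := ((2 / 3 + (2 / 3) ^ 2 + (z + w)) ^ 2 + w : ℝ) with hD₃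
  have h1 : 0 < D₁ := by positivity
  have h2 : 0 < D₂ := by positivity
  have h3 : 0 < D₃ := by positivity
  have key : 0 ≤ (1 + 2 * e) * (e + e ^ 2 + (z + w)) * D₂ * D₃
      - 1 / 2 * ((1 + 2 * (2 * e)) * (2 * e + (2 * e) ^ 2 + (z + w))) * D₁ * D₃
      - 21 / 100 * ((1 + 2 * (2 / 3)) * (2 / 3 + (2 / 3) ^ 2 + (z + w))) * D₁ * D₂ := by
    have hs : 0 ≤ e ^ 7 * (16 / 25 - e) * (9 + 8 * w + 8 * z) + 3 * e ^ 6 * (16 / 25 - e) := by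
      have : 0 ≤ 16 / 25 - e := by linarith
      positivity
    have hr : 0 ≤ (1 + 2 * e) * (e + e ^ 2 + (z + w)) * D₂ * D₃
      - 1 / 2 * ((1 + 2 * (2 * e)) * (2 * e + (2 * e) ^ 2 + (z + w))) * D₁ * D₃
      - 21 / 100 * ((1 + 2 * (2 / 3)) * (2 / 3 + (2 / 3) ^ 2 + (z + w))) * D₁ * D₂
      - (e ^ 7 * (16 / 25 - e) * (9 + 8 * w + 8 * z) + 3 * e ^ 6 * (16 / 25 - e)) := by
      rw [hD₁, hD₂, hD₃]
      ring_nf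
      positivity
    linarith
  have heq : (1 + 2 * e) * (e + e ^ 2 + (z + w)) / D₁
      - 1 / 2 * ((1 + 2 * (2 * e)) * (2 * e + (2 * e) ^ 2 + (z + w)) / D₂)
      - 21 / 100 * ((1 + 2 * (2 / 3)) * (2 / 3 + (2 / 3) ^ 2 + (z + w)) / D₃) =
      ((1 + 2 * e) * (e + e ^ 2 + (z + w)) * D₂ * D₃
      - 1 / 2 * ((1 + 2 * (2 * e)) * (2 * e + (2 * e) ^ 2 + (z + w))) * D₁ * D₃
      - 21 / 100 * ((1 + 2 * (2 / 3)) * (2 / 3 + (2 / 3) ^ 2 + (z + w))) * D₁ * D₂) /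
      (D₁ * D₂ * D₃) := by
    field_simp
  rw [heq]
  positivity

lemma weighted_kernel_nonneg {e : ℝ} (he : 0 < e) (he' : e ≤ 16 / 25) (a : ℂ) (h0 : 0 ≤ a.re)
    (h1 : a.re ≤ 1) :
    0 ≤ ∑ j : Fin 3, (![1, -1 / 2, -21 / 100] : Fin 3 → ℝ) j *
      (1 / (((![1 + e, 1 + 2 * e, 5 / 3] : Fin 3 → ℝ) j : ℂ) - a) -
        1 / (1 - ((![1 + e, 1 + 2 * e, 5 / 3] : Fin 3 → ℝ) j : ℂ) - a)).re := by
  have key : ∀ x : ℝ, 0 < x → (1 / (((1 + x : ℝ) : ℂ) - a) - 1 / (1 - ((1 + x : ℝ) : ℂ) - a)).re =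
      (1 + 2 * x) * (x + x ^ 2 + (a.re * (1 - a.re) + a.im ^ 2)) /
        ((x + x ^ 2 + (a.re * (1 - a.re) + a.im ^ 2)) ^ 2 +
          a.im ^ 2 * (1 - 4 * (a.re * (1 - a.re)))) := by
    intro x hx
    rw [re_one_div_sub_one_div, ← div_add_div_symm (.inl (by linarith)) (.inl (by linarith))
      (sq_nonneg _)]
    ring_nf
  have e3 : (5 / 3 : ℝ) = 1 + 2 / 3 := by norm_num
  rw [Fin.sum_univ_three]
  simp only [Matrix.cons_val_zero, Matrix.cons_val_one, Matrix.cons_val]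
  rw [e3, key _ he, key _ (by linarith), key _ (by norm_num)]
  have hu : 0 ≤ a.re * (1 - a.re) := mul_nonneg h0 (by linarith)
  have hz : 0 ≤ a.re * (1 - a.re) + a.im ^ 2 - a.im ^ 2 * (1 - 4 * (a.re * (1 - a.re))) := by
    nlinarith [mul_nonneg (sq_nonneg a.im) hu]
  have hw : 0 ≤ a.im ^ 2 * (1 - 4 * (a.re * (1 - a.re))) := by
    refine mul_nonneg (sq_nonneg _) ?_
    nlinarith [sq_nonneg (1 - 2 * a.re)]
  have := weighted_kernel_nonneg_aux he he' hz hw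
  rw [sub_add_cancel] at this
  linarith

lemma weighted_real_kernel_lower_bound {e x : ℝ} (he : 0 < e) (he' : e ≤ 16 / 25) (hx : 0 ≤ x)
    (hx' : x ≤ 0.34925) :
    0.5275 / e < ∑ j : Fin 3, (![1, -1 / 2, -21 / 100] : Fin 3 → ℝ) j *
      (1 / ((![1 + e, 1 + 2 * e, 5 / 3] : Fin 3 → ℝ) j - (1 - e * x)) +
        1 / ((![1 + e, 1 + 2 * e, 5 / 3] : Fin 3 → ℝ) j - (1 - (1 - e * x)))) := by
  have hd0 : 0 ≤ e * x := by positivity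
  have hd1 : e * x ≤ 1 / 4 := by nlinarith
  -- the nearby zero
  have h1 : 0.528 + 0.4 * (0.34925 - x) ≤ 1 / (1 + x) - 1 / 2 * (1 / (2 + x)) := by
    have : 1 / (1 + x) - 1 / 2 * (1 / (2 + x)) = (3 + x) / (2 * (1 + x) * (2 + x)) := by
      field_simp; ring
    rw [this, le_div_iff₀ (by positivity)]
    nlinarith [mul_nonneg hx (sub_nonneg.2 hx'), mul_nonneg hx (mul_nonneg hx (sub_nonneg.2 hx'))]
  -- its reflection
  have h2 : 0.441 - 0.25 * (0.35 - x) ≤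
      1 / (1 + e * (1 - x)) - 1 / 2 * (1 / (1 + e * (2 - x))) := by
    have p1 : 0 < 1 + e * (1 - x) := by nlinarith
    have p2 : 0 < 1 + e * (2 - x) := by nlinarith
    have : 1 / (1 + e * (1 - x)) - 1 / 2 * (1 / (1 + e * (2 - x))) =
        (1 + e * (3 - x)) / (2 * (1 + e * (1 - x)) * (1 + e * (2 - x))) := by
      field_simp; ring
    rw [this, le_div_iff₀ (by positivity)]
    have hx1 : 0 ≤ 0.35 - x := by linarith
    have he1 : 0 ≤ 16 / 25 - e := by linarith
    have q1 : (1 - x) * (2 - x) ≤ 2 - 2.65 * x := by nlinarith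
    have q2 : e * e * ((1 - x) * (2 - x)) ≤ 16 / 25 * e * (2 - 2.65 * x) := by
      have : e * e ≤ 16 / 25 * e := by nlinarith
      gcongr
      nlinarith
    have q3 : (0.441 - 0.25 * (0.35 - x)) * (2 * (1 + e * (1 - x)) * (1 + e * (2 - x))) ≤
        (0.707 + 0.5 * x) * (1 + e * (3 - 2 * x) + 16 / 25 * e * (2 - 2.65 * x)) := by
      have : 0 ≤ 0.707 + 0.5 * x := by linarith
      calc _ = (0.707 + 0.5 * x) * (1 + e * (3 - 2 * x) + e * e * ((1 - x) * (2 - x))) := by ring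
        _ ≤ _ := by gcongr
    have q4 : 0 ≤ e * (x * (0.35 - x)) := by positivity
    nlinarith [mul_nonneg he.le hx, mul_nonneg hx he1]
  have h3 : 1 / (2 / 3 + e * x) + 1 / (5 / 3 - e * x) ≤ 2.1 := by
    rw [div_add_div _ _ (by linarith) (by linarith), div_le_iff₀ (by nlinarith)]
    nlinarith [mul_nonneg hd0 (sub_nonneg.2 hd1)]
  rw [Fin.sum_univ_three]
  simp only [Matrix.cons_val_zero, Matrix.cons_val_one, Matrix.cons_val]
  have e1 : 1 / (1 + e - (1 - e * x)) = 1 / (1 + x) / e := by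
    rw [div_div]; congr 1; ring
  have e2 : 1 / (1 + 2 * e - (1 - e * x)) = 1 / (2 + x) / e := by
    rw [div_div]; congr 1; ring
  rw [e1, e2, show 1 + e - (1 - (1 - e * x)) = 1 + e * (1 - x) by ring,
    show 1 + 2 * e - (1 - (1 - e * x)) = 1 + e * (2 - x) by ring,
    show 5 / 3 - (1 - e * x) = 2 / 3 + e * x by ring,
    show 5 / 3 - (1 - (1 - e * x)) = 5 / 3 - e * x by ring]
  have h4 : 0.5275 / e < (0.528 + 0.4 * (0.34925 - x)) / e - 0.25 * (0.35 - x) := by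
    rw [lt_sub_iff_add_lt, ← lt_sub_iff_add_lt', ← sub_div, lt_div_iff₀ he]
    nlinarith
  have h5 : (0.528 + 0.4 * (0.34925 - x)) / e ≤ (1 / (1 + x) - 1 / 2 * (1 / (2 + x))) / e := by
    gcongr
  have h6 : (1 / (1 + x) - 1 / 2 * (1 / (2 + x))) / e =
      1 / (1 + x) / e - 1 / 2 * (1 / (2 + x) / e) := by ring
  linarith

namespace DirichletCharacter

lemma weighted_rpow_nonneg {e : ℝ} (he : 0 < e) (he' : e ≤ 16 / 25) {n : ℕ} (hn : 1 ≤ n) :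
    0 ≤ ∑ j : Fin 3, (![1, -1 / 2, -21 / 100] : Fin 3 → ℝ) j *
      (n : ℝ) ^ (-(![1 + e, 1 + 2 * e, 5 / 3] : Fin 3 → ℝ) j) := by
  rw [Fin.sum_univ_three]
  simp only [Matrix.cons_val_zero, Matrix.cons_val_one, Matrix.cons_val]
  have hn' : (1 : ℝ) ≤ n := by exact_mod_cast hn
  have h1 : (n : ℝ) ^ (-(1 + 2 * e)) ≤ (n : ℝ) ^ (-(1 + e)) :=
    Real.rpow_le_rpow_of_exponent_le hn' (by linarith)
  have h2 : (n : ℝ) ^ (-(5 / 3) : ℝ) ≤ (n : ℝ) ^ (-(1 + e)) :=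
    Real.rpow_le_rpow_of_exponent_le hn' (by linarith)
  have h3 : 0 ≤ (n : ℝ) ^ (-(1 + e)) := by positivity
  linarith

lemma weighted_logDeriv_riemannZeta_ge {e : ℝ} (he : 0 < e) (he' : e ≤ 16 / 25) :
    -(3 / 4 / e) ≤ ∑ j : Fin 3, (![1, -1 / 2, -21 / 100] : Fin 3 → ℝ) j *
      (logDeriv riemannZeta ((![1 + e, 1 + 2 * e, 5 / 3] : Fin 3 → ℝ) j)).re := by
  rw [Fin.sum_univ_three]
  simp only [Matrix.cons_val_zero, Matrix.cons_val_one, Matrix.cons_val]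
  have h1 := neg_re_logDeriv_riemannZeta_add_le he (by linarith)
  have h2 := re_logDeriv_riemannZeta_nonpos (σ := 5 / 3) (by norm_num)
  linarith

/-- Lower bound for the weighted logarithmic derivatives of `L(s, χ*)`, with an arbitrary finite set
of real zeros close to `1` taken into account. -/
lemma weighted_logDeriv_LFunction_ge {N : ℕ} [NeZero N] {χ : DirichletCharacter ℂ N} (hχ : χ ≠ 1)
    {e : ℝ} (he : 0 < e) (he' : e ≤ 16 / 25) (B : Finset ℝ)
    (hB : ∀ β ∈ B, 1 - 0.34925 * e ≤ β ∧ β < 1 ∧ LFunction χ.primitiveCharacter β = 0) :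
    B.card * (0.5275 / e) - 0.145 * Real.log N ≤
      ∑ j : Fin 3, (![1, -1 / 2, -21 / 100] : Fin 3 → ℝ) j *
        (logDeriv (LFunction χ.primitiveCharacter)
          ((![1 + e, 1 + 2 * e, 5 / 3] : Fin 3 → ℝ) j)).re := by
  have hp : χ.primitiveCharacter ≠ 1 := fun h1 => hχ <| by
    rw [← changeLevel_primitiveCharacter χ, h1, map_one]
  have h1 := χ.primitiveCharacter_isPrimitive.sum_zeros_le hp
    (![1, -1 / 2, -21 / 100] : Fin 3 → ℝ) (![1 + e, 1 + 2 * e, 5 / 3] : Fin 3 → ℝ)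
    (fun j => by fin_cases j <;> simp <;> linarith)
    (fun a h0 h1 => weighted_kernel_nonneg he he' a h0 h1) B
    (fun β hβ => ⟨by linarith [(hB β hβ).1], (hB β hβ).2⟩)
  have h2 : B.card * (0.5275 / e) ≤ ∑ β ∈ B, ∑ j : Fin 3,
      (![1, -1 / 2, -21 / 100] : Fin 3 → ℝ) j *
      (1 / ((![1 + e, 1 + 2 * e, 5 / 3] : Fin 3 → ℝ) j - β) +
        1 / ((![1 + e, 1 + 2 * e, 5 / 3] : Fin 3 → ℝ) j - (1 - β))) := by
    rw [← nsmul_eq_mul]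
    refine Finset.card_nsmul_le_sum _ _ _ fun β hβ => ?_
    obtain ⟨hb1, hb2, -⟩ := hB β hβ
    have h3 := weighted_real_kernel_lower_bound (x := (1 - β) / e) he he'
      (div_nonneg (by linarith) he.le) (by rw [div_le_iff₀ he]; linarith)
    rw [mul_div_cancel₀ _ he.ne', sub_sub_cancel] at h3
    exact h3.le
  have h3 : Real.log χ.conductor ≤ Real.log N :=
    Real.log_le_log (by exact_mod_cast Nat.pos_of_ne_zero χ.conductor_ne_zero)
      (by exact_mod_cast Nat.le_of_dvd (NeZero.pos N) χ.conductor_dvd_level)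
  refine (sub_le_sub_right (h2.trans h1) _).trans ?_
  simp only [Fin.sum_univ_three, Matrix.cons_val_zero, Matrix.cons_val_one, Matrix.cons_val]
  have g1 := re_logDeriv_gammaFactor_mono χ.primitiveCharacter (x := 1 + e) (y := 1 + 2 * e)
    (by linarith) (by linarith)
  have g2 := re_logDeriv_gammaFactor_mono χ.primitiveCharacter (x := 1 + e) (y := 5 / 3)
    (by linarith) (by linarith)
  have g3 := re_logDeriv_gammaFactor_nonpos χ.primitiveCharacter (x := 1 + e)
    (by linarith) (by linarith)
  linarith

/-- Two distinct real numbers close to `1` cannot both be zeros of Dirichlet `L`-functions of the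
same level. -/
lemma zero_unique {N : ℕ} [NeZero N] (hN : 3 ≤ N) {χ ψ : DirichletCharacter ℂ N} {β₁ β₂ : ℝ}
    (h₁ : 1 - 1 / (4.0904 * Real.log N) ≤ β₁) (h₁' : β₁ < 1)
    (h₂ : 1 - 1 / (4.0904 * Real.log N) ≤ β₂) (h₂' : β₂ < 1)
    (hχ : LFunction χ β₁ = 0) (hψ : LFunction ψ β₂ = 0) : β₁ = β₂ := by
  by_contra hne
  have hL : 1.0986 < Real.log N := by
    have h3 : Real.log 3 ≤ Real.log N := Real.log_le_log (by norm_num) (by exact_mod_cast hN)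
    linarith [Real.log_three_gt_d9]
  have hL0 : 0 < Real.log N := by linarith
  obtain ⟨e, he_def⟩ : ∃ e, e = 0.7 / Real.log N := ⟨_, rfl⟩
  have he : 0 < e := by rw [he_def]; positivity
  have he' : e ≤ 16 / 25 := by
    rw [he_def, div_le_iff₀ hL0]; linarith
  have heL : Real.log N = 0.7 / e := by rw [he_def]; field_simp
  have hδ : 1 / (4.0904 * Real.log N) ≤ 0.34925 * e := by
    rw [heL, div_le_iff₀ (by positivity)]
    field_simp
    norm_num
  have hb₁ : 1 - 0.34925 * e ≤ β₁ := by linarith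
  have hb₂ : 1 - 0.34925 * e ≤ β₂ := by linarith
  have hχ1 : χ ≠ 1 := by
    rintro rfl
    exact LFunction_one_ne_zero_of_mem_Ioo (by linarith) h₁' hχ
  have hψ1 : ψ ≠ 1 := by
    rintro rfl
    exact LFunction_one_ne_zero_of_mem_Ioo (by linarith) h₂' hψ
  have hχp := LFunction_primitiveCharacter_eq_zero hχ1 (by linarith) hχ
  have hψp := LFunction_primitiveCharacter_eq_zero hψ1 (by linarith) hψ
  have hσ : ∀ j, 1 < (![1 + e, 1 + 2 * e, 5 / 3] : Fin 3 → ℝ) j := by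
    intro j; fin_cases j <;> simp <;> linarith
  have hw := fun (n : ℕ) (hn : 1 ≤ n) => weighted_rpow_nonneg he he' hn
  have hζ := weighted_logDeriv_riemannZeta_ge he he'
  have hnum : 0.435 * Real.log N = 0.3045 / e := by rw [heL]; field_simp; norm_num
  have hnum' : 3 / 4 / e + 0.3045 / e < 2 * (0.5275 / e) := by
    rw [← add_div, ← mul_div_assoc]; gcongr; norm_num
  have hBχ := weighted_logDeriv_LFunction_ge hχ1 he he'
  have hsame : LFunction χ.primitiveCharacter β₂ ≠ 0 := by
    intro hχ2
    have hge := hBχ {β₁, β₂} fun β hβ => by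
      rcases Finset.mem_insert.1 hβ with rfl | hβ
      · exact ⟨hb₁, h₁', hχp⟩
      · rw [Finset.mem_singleton.1 hβ]
        exact ⟨hb₂, h₂', hχ2⟩
    rw [Finset.card_pair hne] at hge
    have hle := weighted_logDeriv_le χ.primitiveCharacter _ _ hσ hw
    push_cast at hge
    linarith
  have hg₁ := hBχ {β₁} fun β hβ => by
    rw [Finset.mem_singleton.1 hβ]
    exact ⟨hb₁, h₁', hχp⟩
  have hg₂ := weighted_logDeriv_LFunction_ge hψ1 he he' {β₂} fun β hβ => by
    rw [Finset.mem_singleton.1 hβ]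
    exact ⟨hb₂, h₂', hψp⟩
  have hmul : χ * ψ ≠ 1 := by
    intro h
    apply hsame
    obtain rfl := eq_inv_of_mul_eq_one_right h
    refine LFunction_primitiveCharacter_eq_zero hχ1 (by linarith) ?_
    have hconj := LFunction_inv_conj hχ1 β₂
    rw [Complex.conj_ofReal, hψ] at hconj
    exact (map_eq_zero _).1 hconj.symm
  have hdiv : χ * ψ⁻¹ ≠ 1 := by
    intro h
    obtain rfl := mul_inv_eq_one.1 h
    exact hsame hψp
  have hg₃ := weighted_logDeriv_LFunction_ge hmul he he' ∅ (by simp)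
  have hg₄ := weighted_logDeriv_LFunction_ge hdiv he he' ∅ (by simp)
  have hle := weighted_logDeriv_combination_le χ ψ _ _ hσ hw
  rw [Finset.card_singleton] at hg₁ hg₂
  rw [Finset.card_empty] at hg₃ hg₄
  push_cast at hg₁ hg₂ hg₃ hg₄
  linarith

end DirichletCharacter

/-- For `q ≥ 3`, the product `ℒ_q` of the Dirichlet `L`-functions modulo `q` has at most
one real zero `β` with `1 - 1/(4.0904 * log q) ≤ β < 1`. -/
theorem at_most_one_real_zero_near_one (q : ℕ) (hq : 3 ≤ q) :
    letI : NeZero q := ⟨by omega⟩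
    ∀ β₁ β₂ : ℝ,
      1 - 1 / (4.0904 * Real.log q) ≤ β₁ → β₁ < 1 →
      1 - 1 / (4.0904 * Real.log q) ≤ β₂ → β₂ < 1 →
      (∏ χ : DirichletCharacter ℂ q, DirichletCharacter.LFunction χ β₁) = 0 →
      (∏ χ : DirichletCharacter ℂ q, DirichletCharacter.LFunction χ β₂) = 0 →
      β₁ = β₂ := by
  have : NeZero q := ⟨by omega⟩
  intro β₁ β₂ h₁ h₁' h₂ h₂' hχ hψ
  obtain ⟨χ, -, hχ⟩ := Finset.prod_eq_zero_iff.1 hχ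
  obtain ⟨ψ, -, hψ⟩ := Finset.prod_eq_zero_iff.1 hψ
  exact DirichletCharacter.zero_unique hq h₁ h₁' h₂ h₂' hχ hψ
end

section
/- For every real number y, 10.91692658 + 18.63362·cos y + 11.4517·cos 2y + 4.7·cos 3y + cos 4y = 8·(0.91 + cos y)²·(0.265 + cos y)², and in particular 10.91692658 + 18.63362·cos y + 11.4517·cos 2y + 4.7·cos 3y + cos 4y ≥ 0. -/
set_option autoImplicit false

open scoped Real

/-- The trigonometric polynomial
`P₁(y) = 10.91692658 + 18.63362 cos y + 11.4517 cos 2y + 4.7 cos 3y + cos 4y`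
equals `8 (0.91 + cos y)² (0.265 + cos y)²` and in particular is non-negative. -/
theorem trig_poly_P1 (y : ℝ) :
    10.91692658 + 18.63362 * Real.cos y + 11.4517 * Real.cos (2 * y)
        + 4.7 * Real.cos (3 * y) + Real.cos (4 * y) =
      8 * (0.91 + Real.cos y) ^ 2 * (0.265 + Real.cos y) ^ 2 ∧
    0 ≤ 10.91692658 + 18.63362 * Real.cos y + 11.4517 * Real.cos (2 * y)
        + 4.7 * Real.cos (3 * y) + Real.cos (4 * y) := by
  have h4 : Real.cos (4 * y) = 8 * Real.cos y ^ 4 - 8 * Real.cos y ^ 2 + 1 := by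
    rw [show 4 * y = 2 * (2 * y) by ring, Real.cos_two_mul, Real.cos_two_mul]
    ring
  have key : 10.91692658 + 18.63362 * Real.cos y + 11.4517 * Real.cos (2 * y)
        + 4.7 * Real.cos (3 * y) + Real.cos (4 * y) =
      8 * (0.91 + Real.cos y) ^ 2 * (0.265 + Real.cos y) ^ 2 := by
    rw [h4, Real.cos_three_mul, Real.cos_two_mul]
    ring
  refine ⟨key, ?_⟩
  rw [key]
  positivity
end
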